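/- Fix θ ∈ ℝ. For every rectangle B = {z ∈ ℂ : a < Re z < b, c < Im z < d} (with a < b, c < d), the Haar probability measure of the set {A ∈ U(N) : log P_N(A,θ)/√((1/2)·log N) ∈ B} converges, as N → ∞, to (1/2π)·∫∫_B e^{−(x²+y²)/2} dx dy; that is, the real and imaginary parts of log P_N(A,θ), each normalized by √((1/2)·log N), converge jointly in distribution to two independent standard Gaussian random variables. -/

import Mathlib

open MeasureTheory Matrix Filter

noncomputable section

/-- Borel-type measurable structure on matrices, induced entrywise. -/
instance matrixMeasurableSpace {m n R : Type*} [MeasurableSpace R] :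
    MeasurableSpace (Matrix m n R) :=
  inferInstanceAs (MeasurableSpace (m → n → R))

/-- `μ` is the Haar probability measure on a compact group: the (unique) left-translation
invariant probability measure. -/
def IsHaarProb {G : Type*} [Group G] [MeasurableSpace G] (μ : Measure G) : Prop :=
  IsProbabilityMeasure μ ∧ ∀ B : G, μ.map (fun A => B * A) = μ

/-- `log P_N(A,θ) := Σ_j Log(1 − λ_j e^{−iθ})`, the sum over the eigenvalues `λ_j = e^{iθ_j}`
of `A` (the roots of its characteristic polynomial, with multiplicity) of the principal
logarithm of the corresponding factor `1 − e^{i(θ_j − θ)}` of `P_N(A,θ)`. -/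
def logCharPoly (N : ℕ) (A : Matrix.unitaryGroup (Fin N) ℂ) (θ : ℝ) : ℂ :=
  (((A : Matrix (Fin N) (Fin N) ℂ).charpoly.roots).map
    (fun lam => Complex.log (1 - lam * Complex.exp (-(θ : ℂ) * Complex.I)))).sum

namespace KeatingSnaith

section Spectral

variable {m : Type*} [Fintype m] [DecidableEq m]

open Polynomial in
lemma det_aeval (A : Matrix m m ℂ) (q : ℂ[X]) :
    (aeval A q).det = (A.charpoly.roots.map fun l => q.eval l).prod := by
  have hcard : Multiset.card A.charpoly.roots = Fintype.card m := by
    rw [← (IsAlgClosed.splits A.charpoly).natDegree_eq_card_roots, charpoly_natDegree_eq_dim]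
  have hX : ∀ c : ℂ, (aeval A (X - C c)).det
      = (A.charpoly.roots.map fun l => (X - C c).eval l).prod := by
    intro c
    have h1 := Matrix.eval_charpoly A c
    have h3 : aeval A (X - C c) = -(scalar m c - A) := by
      simp [Algebra.algebraMap_eq_smul_one, smul_one_eq_diagonal]
    rw [h3, det_neg, ← h1, (IsAlgClosed.splits A.charpoly).eval_eq_prod_roots_of_monic
      A.charpoly_monic, ← hcard, ← Multiset.card_map (fun l => c - l) A.charpoly.roots,
      ← Multiset.prod_map_neg, Multiset.map_map]
    simp
  have hprod : ∀ s : Multiset ℂ, (aeval A (s.map (fun a => X - C a)).prod).det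
      = (A.charpoly.roots.map fun l => ((s.map (fun a => X - C a)).prod).eval l).prod := by
    intro s
    induction s using Multiset.induction_on with
    | empty => simp
    | cons a s ih =>
      rw [Multiset.map_cons, Multiset.prod_cons, map_mul, det_mul, ih, hX, ← Multiset.prod_map_mul]
      simp only [eval_mul]
  rw [(IsAlgClosed.splits q).eq_prod_roots, map_mul, det_mul, hprod]
  simp only [eval_mul, eval_C]
  rw [Multiset.prod_map_mul, Multiset.map_const', Multiset.prod_replicate, hcard]
  simp [Algebra.algebraMap_eq_smul_one, smul_one_eq_diagonal]

open Polynomial in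
lemma roots_charpoly_aeval (A : Matrix m m ℂ) (q : ℂ[X]) :
    (aeval A q).charpoly.roots = A.charpoly.roots.map fun l => q.eval l := by
  have h : (aeval A q).charpoly = ((A.charpoly.roots.map fun l => q.eval l).map
      fun c => X - C c).prod := by
    refine Polynomial.funext fun x => ?_
    have h3 : scalar m x - aeval A q = aeval A (C x - q) := by
      simp [Algebra.algebraMap_eq_smul_one, smul_one_eq_diagonal]
    rw [Matrix.eval_charpoly, h3, det_aeval, eval_multiset_prod, Multiset.map_map,
      Multiset.map_map]
    simp
  rw [h, roots_multiset_prod_X_sub_C]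

open Polynomial in
lemma trace_aeval (A : Matrix m m ℂ) (q : ℂ[X]) :
    (aeval A q).trace = (A.charpoly.roots.map fun l => q.eval l).sum := by
  rw [trace_eq_sum_roots_charpoly, roots_charpoly_aeval]

/-- The branch of `log det (1 - A)` given by the sum of the principal logarithms of the
eigenvalues of `1 - A`. -/
def logDet (A : Matrix m m ℂ) : ℂ :=
  (A.charpoly.roots.map fun l => Complex.log (1 - l)).sum

open Polynomial in
lemma roots_charpoly_smul (c : ℂ) (A : Matrix m m ℂ) :
    (c • A).charpoly.roots = A.charpoly.roots.map fun l => c * l := by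
  have := roots_charpoly_aeval A (C c * X)
  simpa [Algebra.algebraMap_eq_smul_one] using this

open Polynomial in
lemma det_one_sub_smul (c : ℂ) (A : Matrix m m ℂ) :
    (1 - c • A).det = (A.charpoly.roots.map fun l => 1 - c * l).prod := by
  have := det_aeval A (1 - C c * X)
  simpa [Algebra.algebraMap_eq_smul_one] using this

lemma det_one_sub (A : Matrix m m ℂ) :
    (1 - A).det = (A.charpoly.roots.map fun l => 1 - l).prod := by
  simpa using det_one_sub_smul 1 A

lemma det_one_sub_eq_zero_iff (A : Matrix m m ℂ) :
    (1 - A).det = 0 ↔ (1 : ℂ) ∈ A.charpoly.roots := by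
  rw [det_one_sub, Multiset.prod_eq_zero_iff, Multiset.mem_map]
  constructor
  · rintro ⟨a, ha, h⟩
    rwa [← sub_eq_zero.1 h] at ha
  · exact fun h => ⟨1, h, by simp⟩

lemma logCharPoly_eq_logDet (N : ℕ) (A : Matrix.unitaryGroup (Fin N) ℂ) (θ : ℝ) :
    logCharPoly N A θ = logDet (Complex.exp (-(θ : ℂ) * Complex.I) •
      (A : Matrix (Fin N) (Fin N) ℂ)) := by
  rw [logDet, roots_charpoly_smul, logCharPoly, Multiset.map_map]
  simp only [Function.comp_def, mul_comm]

open scoped Matrix.Norms.L2Operator in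
lemma norm_unitary_le (A : Matrix.unitaryGroup m ℂ) : ‖(A : Matrix m m ℂ)‖ ≤ 1 := by
  rcases subsingleton_or_nontrivial (Matrix m m ℂ) with h | h
  · rw [Subsingleton.elim (A : Matrix m m ℂ) 0, norm_zero]; exact zero_le_one
  · exact (CStarRing.norm_of_mem_unitary A.2).le

open scoped Matrix.Norms.L2Operator in
lemma det_one_sub_smul_ne_zero {A : Matrix m m ℂ} (hA : ‖A‖ ≤ 1) {c : ℂ} (hc : ‖c‖ < 1) :
    (1 - c • A).det ≠ 0 := by
  have h : ‖c • A‖ < 1 := by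
    rw [norm_smul]
    nlinarith [norm_nonneg A, norm_nonneg c]
  exact ((isUnit_iff_isUnit_det _).1 (isUnit_one_sub_of_norm_lt_one h)).ne_zero

open scoped Matrix.Norms.L2Operator in
lemma norm_le_one_of_mem_roots {A : Matrix m m ℂ} (hA : ‖A‖ ≤ 1) {l : ℂ}
    (hl : l ∈ A.charpoly.roots) : ‖l‖ ≤ 1 := by
  by_contra! h
  have h0 : l ≠ 0 := by rintro rfl; simp at h; linarith
  refine det_one_sub_smul_ne_zero hA (c := l⁻¹) ?_ ?_
  · rw [norm_inv]; exact inv_lt_one_of_one_lt₀ h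
  · rw [det_one_sub_smul, Multiset.prod_eq_zero_iff, Multiset.mem_map]
    exact ⟨l, hl, by simp [h0]⟩

end Spectral
section Branch

lemma one_sub_mul_mem_slitPlane {z : ℂ} (hz : ‖z‖ ≤ 1) (hz1 : z ≠ 1) {t : ℝ}
    (ht : t ∈ Set.Icc (0 : ℝ) 1) : 1 - (t : ℂ) * z ∈ Complex.slitPlane := by
  rw [Complex.mem_slitPlane_iff]
  have hzr : z.re ≤ 1 := (Complex.re_le_norm z).trans hz
  left
  simp only [Complex.sub_re, Complex.one_re, Complex.mul_re, Complex.ofReal_re,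
    Complex.ofReal_im, zero_mul, sub_zero]
  rcases hzr.lt_or_eq with h | h
  · rcases ht.1.eq_or_lt with h' | h'
    · rw [← h']; norm_num
    · nlinarith [ht.2]
  · exfalso
    have : z.im = 0 := by
      have h3 : ‖z‖ ^ 2 ≤ 1 := by nlinarith [norm_nonneg z]
      rw [← Complex.normSq_eq_norm_sq, Complex.normSq_apply, h] at h3
      nlinarith
    exact hz1 (Complex.ext h this)

lemma sub_eq_sub_of_exp_eq {f g : ℝ → ℂ} (hf : ContinuousOn f (Set.Icc 0 1))
    (hg : ContinuousOn g (Set.Icc 0 1))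
    (h : ∀ t ∈ Set.Icc (0 : ℝ) 1, Complex.exp (f t) = Complex.exp (g t)) :
    f 1 - f 0 = g 1 - g 0 := by
  have hd : ContinuousOn (fun t => (f t - g t) / (2 * Real.pi * Complex.I)) (Set.Icc 0 1) :=
    (hf.sub hg).div_const _
  have hr : ContinuousOn (fun t => ((f t - g t) / (2 * Real.pi * Complex.I)).re)
      (Set.Icc 0 1) := Complex.continuous_re.comp_continuousOn hd
  have hInt : ∀ t ∈ Set.Icc (0 : ℝ) 1, ∃ n : ℤ, f t = g t + n * (2 * Real.pi * Complex.I) :=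
    fun t ht => Complex.exp_eq_exp_iff_exists_int.1 (h t ht)
  choose! n hn using hInt
  have hre : ∀ t ∈ Set.Icc (0 : ℝ) 1, ((f t - g t) / (2 * Real.pi * Complex.I)).re = n t := by
    intro t ht
    rw [hn t ht, add_sub_cancel_left, mul_div_assoc, div_self Complex.two_pi_I_ne_zero]
    simp
  have hnc : ContinuousOn n (Set.Icc 0 1) := by
    have := hr.congr (g := fun t => (n t : ℝ)) (fun t ht => (hre t ht).symm)
    exact Int.isClosedEmbedding_coe_real.isInducing.continuousOn_iff.2 this
  have := isPreconnected_Icc.constant hnc (Set.left_mem_Icc.2 zero_le_one)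
    (Set.right_mem_Icc.2 zero_le_one)
  rw [hn 1 (by simp), hn 0 (by simp), this]
  ring

open unitInterval in
lemma exists_continuous_log {q : ℝ → ℝ → ℂ} (hq : Continuous fun p : ℝ × ℝ => q p.1 p.2)
    (h0 : ∀ s ∈ Set.Icc (0 : ℝ) 1, ∀ t ∈ Set.Icc (0 : ℝ) 1, q s t ≠ 0) :
    ∃ f : ℝ → ℝ → ℂ, (Continuous fun p : ℝ × ℝ => f p.1 p.2) ∧
      ∀ s ∈ Set.Icc (0 : ℝ) 1, ∀ t ∈ Set.Icc (0 : ℝ) 1, Complex.exp (f s t) = q s t := by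
  let c : ℝ → ℝ := fun t => Set.projIcc (0 : ℝ) 1 zero_le_one t
  have hc : Continuous c := continuous_subtype_val.comp continuous_projIcc
  have hmem : ∀ t, c t ∈ Set.Icc (0 : ℝ) 1 := fun t => (Set.projIcc (0 : ℝ) 1 zero_le_one t).2
  have hid : ∀ t ∈ Set.Icc (0 : ℝ) 1, c t = t := fun t ht => by
    simp only [c, Set.projIcc_of_mem zero_le_one ht]
  have hU : IsSimplyConnected (Set.univ : Set (ℝ × ℝ)) :=
    have : ContractibleSpace (Set.univ : Set (ℝ × ℝ)) :=
      (Homeomorph.Set.univ (ℝ × ℝ)).contractibleSpace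
    inferInstanceAs (SimplyConnectedSpace (Set.univ : Set (ℝ × ℝ)))
  obtain ⟨f, hf, he⟩ := Complex.exists_continuousOn_eqOn_exp_comp hU isOpen_univ
    (g := fun p : ℝ × ℝ => q (c p.1) (c p.2))
    (hq.comp (((hc.comp continuous_fst).prodMk (hc.comp continuous_snd)))).continuousOn
    (by rintro ⟨p, -, hp⟩; exact h0 _ (hmem _) _ (hmem _) hp)
  refine ⟨fun s t => f (s, t), continuousOn_univ.1 hf, fun s hs t ht => ?_⟩
  have := he (Set.mem_univ (s, t))
  simpa [hid s hs, hid t ht] using this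

end Branch

section Schur

variable {n : Type*} [Fintype n] [DecidableEq n]

/-- For a unitary matrix `A` with `1 - A` of block form, one minus the Schur complement of the
corner entry of `1 - A`. -/
def schurPart (A : Matrix (Unit ⊕ n) (Unit ⊕ n) ℂ) : Matrix n n ℂ :=
  of fun i j => A (.inr i) (.inr j) +
    (1 - A (.inl ()) (.inl ()))⁻¹ * (A (.inr i) (.inl ()) * A (.inl ()) (.inr j))

lemma schurPart_mem_unitaryGroup (A : Matrix.unitaryGroup (Unit ⊕ n) ℂ)
    (ha : (A : Matrix (Unit ⊕ n) (Unit ⊕ n) ℂ) (.inl ()) (.inl ()) ≠ 1) :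
    schurPart (A : Matrix (Unit ⊕ n) (Unit ⊕ n) ℂ) ∈ Matrix.unitaryGroup n ℂ := by
  obtain ⟨A, hA⟩ := A
  rw [mem_unitaryGroup_iff'] at hA ⊢
  have hent : ∀ x y, star (A (.inl ()) x) * A (.inl ()) y + ∑ i, star (A (.inr i) x) * A (.inr i) y
      = (1 : Matrix (Unit ⊕ n) (Unit ⊕ n) ℂ) x y := by
    intro x y
    rw [← hA, mul_apply, Fintype.sum_sum_type]
    simp
  simp only at ha
  ext j k
  have e1 := hent (.inr j) (.inr k)
  have e2 := hent (.inr j) (.inl ())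
  have e3 := hent (.inl ()) (.inr k)
  have e4 := hent (.inl ()) (.inl ())
  rw [mul_apply]
  simp only [schurPart, star_apply, of_apply]
  have hexp : ∀ i, star (A (.inr i) (.inr j) + (1 - A (.inl ()) (.inl ()))⁻¹ *
        (A (.inr i) (.inl ()) * A (.inl ()) (.inr j))) *
      (A (.inr i) (.inr k) + (1 - A (.inl ()) (.inl ()))⁻¹ *
        (A (.inr i) (.inl ()) * A (.inl ()) (.inr k)))
      = star (A (.inr i) (.inr j)) * A (.inr i) (.inr k)
        + (1 - A (.inl ()) (.inl ()))⁻¹ * A (.inl ()) (.inr k) *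
          (star (A (.inr i) (.inr j)) * A (.inr i) (.inl ()))
        + star (1 - A (.inl ()) (.inl ()))⁻¹ * star (A (.inl ()) (.inr j)) *
          (star (A (.inr i) (.inl ())) * A (.inr i) (.inr k))
        + star (1 - A (.inl ()) (.inl ()))⁻¹ * star (A (.inl ()) (.inr j)) *
          ((1 - A (.inl ()) (.inl ()))⁻¹ * A (.inl ()) (.inr k)) *
          (star (A (.inr i) (.inl ())) * A (.inr i) (.inl ())) := by
    intro i
    simp only [star_add, star_mul', star_inv₀]
    ring
  simp only [hexp, Finset.sum_add_distrib, ← Finset.mul_sum]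
  have h1 : (1 - A (.inl ()) (.inl ())) ≠ 0 := sub_ne_zero.2 ha.symm
  have h2 : (1 - star (A (.inl ()) (.inl ()))) ≠ 0 := by
    rw [← star_one ℂ, ← star_sub]; exact star_ne_zero.2 h1
  have f1 : (1 : Matrix n n ℂ) j k = (1 : Matrix (Unit ⊕ n) (Unit ⊕ n) ℂ) (.inr j) (.inr k) := by
    simp [one_apply]
  have g2 := eq_sub_of_add_eq' e2
  have g3 := eq_sub_of_add_eq' e3
  have g4 := eq_sub_of_add_eq' e4
  rw [f1, ← e1, g2, g3, g4]
  simp only [ne_eq, reduceCtorEq, not_false_eq_true, one_apply_ne, one_apply_eq, star_inv₀,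
    star_sub, star_one]
  field_simp
  ring

lemma det_one_sub_mul_diagonal (A : Matrix (Unit ⊕ n) (Unit ⊕ n) ℂ)
    (ha : A (.inl ()) (.inl ()) ≠ 1) (s : ℂ) :
    (1 - A * diagonal (Sum.elim (fun _ => 1) (fun _ => s))).det =
      (1 - A (.inl ()) (.inl ())) * (1 - s • schurPart A).det := by
  have h1 : (1 - A (.inl ()) (.inl ())) ≠ 0 := sub_ne_zero.2 ha.symm
  let B : Matrix Unit Unit ℂ := of fun _ _ => 1 - A (.inl ()) (.inl ())
  let C : Matrix Unit Unit ℂ := of fun _ _ => (1 - A (.inl ()) (.inl ()))⁻¹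
  let _ : Invertible B := ⟨C, by ext; simp [B, C, mul_apply, h1],
    by ext; simp [B, C, mul_apply, h1]⟩
  have hM : 1 - A * diagonal (Sum.elim (fun _ => 1) (fun _ => s)) =
      fromBlocks B (of fun _ j => - (A (.inl ()) (.inr j) * s)) (of fun i _ => - A (.inr i) (.inl ()))
        (of fun i j => (1 : Matrix n n ℂ) i j - A (.inr i) (.inr j) * s) := by
    ext (i | i) (j | j) <;> simp [mul_diagonal, B, one_apply]
  rw [hM, det_fromBlocks₁₁]
  congr 1
  · simp [B]
  · congr 1
    ext i j
    simp only [schurPart, Matrix.sub_apply, mul_apply, of_apply, Matrix.smul_apply, smul_eq_mul]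
    rw [show ⅟B = C from rfl]
    simp [C]
    ring

open scoped Matrix.Norms.L2Operator in
lemma logDet_eq_add (A : Matrix.unitaryGroup (Unit ⊕ n) ℂ)
    (ha : (A : Matrix (Unit ⊕ n) (Unit ⊕ n) ℂ) (.inl ()) (.inl ()) ≠ 1)
    (hdet : (1 - schurPart (A : Matrix (Unit ⊕ n) (Unit ⊕ n) ℂ)).det ≠ 0) :
    logDet (A : Matrix (Unit ⊕ n) (Unit ⊕ n) ℂ) =
      Complex.log (1 - (A : Matrix (Unit ⊕ n) (Unit ⊕ n) ℂ) (.inl ()) (.inl ())) +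
      logDet (schurPart (A : Matrix (Unit ⊕ n) (Unit ⊕ n) ℂ)) := by
  have hWu := norm_unitary_le ⟨_, schurPart_mem_unitaryGroup A ha⟩
  have hAu := norm_unitary_le A
  obtain ⟨A, hA⟩ := A
  simp only at *
  set a := A (.inl ()) (.inl ()) with hadef
  set W := schurPart A with hW
  let D : ℝ → Matrix (Unit ⊕ n) (Unit ⊕ n) ℂ :=
    fun s => diagonal (Sum.elim (fun _ => 1) (fun _ => (s : ℂ)))
  let q : ℝ → ℝ → ℂ := fun s t => (1 - (t : ℂ) • (A * D s)).det
  have hDn : ∀ s ∈ Set.Icc (0 : ℝ) 1, ‖A * D s‖ ≤ 1 := by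
    intro s hs
    have : ‖D s‖ ≤ 1 := by
      rw [l2_opNorm_diagonal, pi_norm_le_iff_of_nonneg zero_le_one]
      rintro (i | i)
      · simp
      · simpa [abs_of_nonneg hs.1] using hs.2
    exact (norm_mul_le _ _).trans (mul_le_one₀ hAu (norm_nonneg _) this)
  have hq1 : ∀ s, q s 1 = (1 - a) * (1 - (s : ℂ) • W).det := fun s => by
    simpa [q] using det_one_sub_mul_diagonal A ha s
  have hsW : ∀ s ∈ Set.Icc (0 : ℝ) 1, (1 - (s : ℂ) • W).det ≠ 0 := by
    intro s hs
    rcases hs.2.lt_or_eq with h | h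
    · exact det_one_sub_smul_ne_zero hWu (by simpa [abs_of_nonneg hs.1] using h)
    · simpa [h] using hdet
  have h1a : (1 : ℂ) - a ≠ 0 := sub_ne_zero.2 ha.symm
  have hq0 : ∀ s ∈ Set.Icc (0 : ℝ) 1, ∀ t ∈ Set.Icc (0 : ℝ) 1, q s t ≠ 0 := by
    intro s hs t ht
    rcases ht.2.lt_or_eq with h | h
    · exact det_one_sub_smul_ne_zero (hDn s hs) (by simpa [abs_of_nonneg ht.1] using h)
    · rw [h, hq1]
      exact mul_ne_zero h1a (hsW s hs)
  have hqc : Continuous fun p : ℝ × ℝ => q p.1 p.2 := by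
    have hD : Continuous D := by
      refine Continuous.matrix_diagonal (continuous_pi ?_)
      rintro (i | i)
      · exact continuous_const
      · exact Complex.continuous_ofReal
    exact Continuous.matrix_det (continuous_const.sub
      ((Complex.continuous_ofReal.comp continuous_snd).smul
        (continuous_const.mul (hD.comp continuous_fst))))
  have hslit : ∀ z : ℂ, ‖z‖ ≤ 1 → z ≠ 1 → ∀ t ∈ Set.Icc (0 : ℝ) 1,
      1 - (t : ℂ) * z ∈ Complex.slitPlane := fun z hz hz1 t ht =>
    one_sub_mul_mem_slitPlane hz hz1 ht
  have hlogc : ∀ z : ℂ, ‖z‖ ≤ 1 → z ≠ 1 →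
      ContinuousOn (fun t : ℝ => Complex.log (1 - (t : ℂ) * z)) (Set.Icc 0 1) :=
    fun z hz hz1 => ContinuousOn.clog (by fun_prop) (hslit z hz hz1)
  have hsum : ∀ S : Multiset ℂ, (∀ z ∈ S, ‖z‖ ≤ 1 ∧ z ≠ 1) →
      ContinuousOn (fun t : ℝ => (S.map fun z => Complex.log (1 - (t : ℂ) * z)).sum)
        (Set.Icc 0 1) ∧
      ∀ t ∈ Set.Icc (0 : ℝ) 1, Complex.exp (S.map fun z => Complex.log (1 - (t : ℂ) * z)).sum
        = (S.map fun z => 1 - (t : ℂ) * z).prod := by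
    intro S
    induction S using Multiset.induction_on with
    | empty => simp [continuousOn_const]
    | cons z S ih =>
      intro h
      obtain ⟨i1, i2⟩ := ih fun z hz => h z (Multiset.mem_cons_of_mem hz)
      obtain ⟨z1, z2⟩ := h z (Multiset.mem_cons_self _ _)
      simp only [Multiset.map_cons, Multiset.sum_cons, Multiset.prod_cons]
      refine ⟨(hlogc z z1 z2).add i1, fun t ht => ?_⟩
      rw [Complex.exp_add, i2 t ht, Complex.exp_log
        (Complex.slitPlane_ne_zero (hslit z z1 z2 t ht))]
  have hD1 : D 1 = 1 := by
    simp only [D]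
    rw [← diagonal_one]
    congr 1
    ext (i | i) <;> simp
  have hA1 : (1 - A).det ≠ 0 := by
    have := hq0 1 (by simp) 1 (by simp)
    simpa [q, hD1] using this
  obtain ⟨cA, eA⟩ := hsum A.charpoly.roots 
    (fun z hz => ⟨norm_le_one_of_mem_roots hAu hz, by
      rintro rfl; exact hA1 ((det_one_sub_eq_zero_iff A).2 hz)⟩)
  obtain ⟨cW, eW⟩ := hsum W.charpoly.roots
    (fun z hz => ⟨norm_le_one_of_mem_roots hWu hz, by
      rintro rfl; exact hdet ((det_one_sub_eq_zero_iff W).2 hz)⟩)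
  have hna : ‖a‖ ≤ 1 := entry_norm_bound_of_unitary hA _ _
  obtain ⟨f, hf, he⟩ := exists_continuous_log hqc hq0
  have h00 : (0 : ℝ) ∈ Set.Icc (0 : ℝ) 1 := by simp
  have h11 : (1 : ℝ) ∈ Set.Icc (0 : ℝ) 1 := by simp
  have hq00 : ∀ t ∈ Set.Icc (0 : ℝ) 1, q 0 t = 1 - t * a := by
    intro t ht
    have h := Complex.slitPlane_ne_zero (hslit a hna ha t ht)
    have := det_one_sub_mul_diagonal ((t : ℂ) • A) (by
      simpa [eq_comm] using sub_ne_zero.1 h) 0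
    simpa [q, D] using this
  have E1 := sub_eq_sub_of_exp_eq (f := fun t => f 0 t)
    (g := fun t => Complex.log (1 - (t : ℂ) * a))
    (hf.comp (Continuous.prodMk continuous_const continuous_id)).continuousOn (hlogc a hna ha)
    (fun t ht => by
      rw [he 0 h00 t ht, Complex.exp_log (Complex.slitPlane_ne_zero (hslit a hna ha t ht)), hq00 t ht])
  have E2 := sub_eq_sub_of_exp_eq (f := fun s => f s 1)
    (g := fun t => (W.charpoly.roots.map fun z => Complex.log (1 - (t : ℂ) * z)).sum
      + Complex.log (1 - a))
    (hf.comp (Continuous.prodMk continuous_id continuous_const)).continuousOn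
    (cW.add continuousOn_const)
    (fun t ht => by
      rw [he t ht 1 h11, hq1, Complex.exp_add, eW t ht, Complex.exp_log h1a, det_one_sub_smul,
        mul_comm])
  have E3 := sub_eq_sub_of_exp_eq (f := fun t => f 1 t)
    (g := fun t => (A.charpoly.roots.map fun z => Complex.log (1 - (t : ℂ) * z)).sum)
    (hf.comp (Continuous.prodMk continuous_const continuous_id)).continuousOn cA
    (fun t ht => by
      rw [he 1 h11 t ht, eA t ht, ← det_one_sub_smul]
      simp only [q, hD1, mul_one])
  have E4 := sub_eq_sub_of_exp_eq (f := fun s => f s 0) (g := fun _ => 0)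
    (hf.comp (Continuous.prodMk continuous_id continuous_const)).continuousOn continuousOn_const
    (fun t ht => by rw [he t ht 0 h00]; simp [q])
  simp only [Complex.ofReal_one, one_mul, Complex.ofReal_zero, zero_mul, sub_zero,
    Complex.log_one, Multiset.map_const', Multiset.sum_replicate, smul_zero] at E1 E2 E3 E4
  rw [logDet, logDet]
  linear_combination E1 + E2 - E3 - E4

end Schur

section Measurability

variable {m : Type*} [Fintype m] [DecidableEq m] {Ω : Type*} [MeasurableSpace Ω]

lemma measurable_of_entries {k l R : Type*} [MeasurableSpace R] {f : Ω → Matrix k l R}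
    (h : ∀ i j, Measurable fun ω => f ω i j) : Measurable f :=
  measurable_pi_iff.2 fun i => measurable_pi_iff.2 fun j => h i j

lemma measurable_entry {k l R : Type*} [MeasurableSpace R] {f : Ω → Matrix k l R}
    (hf : Measurable f) (i : k) (j : l) : Measurable fun ω => f ω i j :=
  (measurable_pi_apply j).comp ((measurable_pi_apply i).comp hf)

lemma measurable_matrix_mul {f g : Ω → Matrix m m ℂ} (hf : Measurable f) (hg : Measurable g) :
    Measurable fun ω => f ω * g ω :=
  measurable_of_entries fun i j => by
    simp only [mul_apply]
    exact Finset.measurable_sum _ fun k _ => (measurable_entry hf i k).mul (measurable_entry hg k j)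

lemma measurable_matrix_pow {f : Ω → Matrix m m ℂ} (hf : Measurable f) (k : ℕ) :
    Measurable fun ω => f ω ^ k := by
  induction k with
  | zero => simp only [pow_zero]; exact measurable_const
  | succ k ih => simp only [pow_succ]; exact measurable_matrix_mul ih hf

open Polynomial in
lemma measurable_trace_aeval {f : Ω → Matrix m m ℂ} (hf : Measurable f) (q : ℂ[X]) :
    Measurable fun ω => (aeval (f ω) q).trace := by
  simp only [aeval_eq_sum_range, trace_sum, trace_smul, smul_eq_mul]
  refine Finset.measurable_sum _ fun k _ => Measurable.const_mul ?_ _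
  simp only [trace, diag_apply]
  exact Finset.measurable_sum _ fun i _ => measurable_entry (measurable_matrix_pow hf k) i i

lemma measurable_det_one_sub {f : Ω → Matrix m m ℂ} (hf : Measurable f) :
    Measurable fun ω => (1 - f ω).det := by
  simp only [det_apply]
  refine Finset.measurable_sum _ fun σ _ => Measurable.const_smul ?_ _
  refine Finset.measurable_prod _ fun i _ => ?_
  simp only [Matrix.sub_apply]
  exact measurable_const.sub (measurable_entry hf _ _)

instance : MeasurableMul₂ (Matrix.unitaryGroup m ℂ) where
  measurable_mul := Measurable.subtype_mk (measurable_matrix_mul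
    (measurable_subtype_coe.comp measurable_fst) (measurable_subtype_coe.comp measurable_snd))

end Measurability

section LogPoly

open Polynomial in
/-- Truncated power series of `z ↦ -log (1 - r z)`. -/
def logPoly (r : ℝ) (M : ℕ) : ℂ[X] :=
  ∑ n ∈ Finset.range M, C ((r : ℂ) ^ n / n) * X ^ n

lemma eval_logPoly (r : ℝ) (M : ℕ) (z : ℂ) :
    (logPoly r M).eval z = ∑ n ∈ Finset.range M, (r * z) ^ n / n := by
  simp only [logPoly, Polynomial.eval_finsetSum, Polynomial.eval_mul, Polynomial.eval_C,
    Polynomial.eval_pow, Polynomial.eval_X, mul_pow]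
  exact Finset.sum_congr rfl fun n _ => by ring

/-- A sequence of radii in `[0, 1)` tending to `1`. -/
def radius (l : ℕ) : ℝ := 1 - 1 / ((l : ℝ) + 1)

lemma radius_nonneg (l : ℕ) : 0 ≤ radius l := by
  have : 1 / ((l : ℝ) + 1) ≤ 1 := by
    rw [div_le_one (by positivity)]; linarith [(Nat.cast_nonneg l : (0 : ℝ) ≤ l)]
  simp only [radius]; linarith

lemma radius_lt_one (l : ℕ) : radius l < 1 := by
  have : 0 < 1 / ((l : ℝ) + 1) := by positivity
  simp only [radius]; linarith

lemma tendsto_radius : Tendsto radius atTop (nhds 1) := by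
  have h := (tendsto_const_nhds (x := (1 : ℝ))).sub
    (tendsto_one_div_add_atTop_nhds_zero_nat (𝕜 := ℝ))
  rw [sub_zero] at h
  exact h

lemma tendsto_eval_logPoly {z : ℂ} (hz : ‖z‖ ≤ 1) (l : ℕ) :
    Tendsto (fun M => (logPoly (radius l) M).eval z) atTop
      (nhds (-Complex.log (1 - radius l * z))) := by
  simp only [eval_logPoly]
  refine (Complex.hasSum_taylorSeries_neg_log ?_).tendsto_sum_nat
  rw [norm_mul, Complex.norm_real, Real.norm_of_nonneg (radius_nonneg l)]
  nlinarith [radius_nonneg l, radius_lt_one l, norm_nonneg z]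

lemma tendsto_log_one_sub_radius_mul {z : ℂ} (hz : ‖z‖ ≤ 1) (hz1 : z ≠ 1) :
    Tendsto (fun l => Complex.log (1 - radius l * z)) atTop (nhds (Complex.log (1 - z))) := by
  have h := one_sub_mul_mem_slitPlane hz hz1 (t := 1) (by simp)
  rw [Complex.ofReal_one, one_mul] at h
  refine (continuousAt_clog h).tendsto.comp ?_
  have : Tendsto (fun l => (1 : ℂ) - radius l * z) atTop (nhds (1 - (1 : ℝ) * z)) :=
    tendsto_const_nhds.sub
      (((Complex.continuous_ofReal.tendsto 1).comp tendsto_radius).mul tendsto_const_nhds)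
  simpa using this

lemma tendsto_multiset_sum_map {S : Multiset ℂ} {f : ℕ → ℂ → ℂ} {g : ℂ → ℂ}
    (h : ∀ z ∈ S, Tendsto (fun k => f k z) atTop (nhds (g z))) :
    Tendsto (fun k => (S.map (f k)).sum) atTop (nhds (S.map g).sum) := by
  induction S using Multiset.induction_on with
  | empty => simp
  | cons z S ih =>
    simp only [Multiset.map_cons, Multiset.sum_cons]
    exact (h z (Multiset.mem_cons_self _ _)).add (ih fun w hw => h w (Multiset.mem_cons_of_mem hw))

end LogPoly

section RegLogDet

variable {m : Type*} [Fintype m] [DecidableEq m]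

/-- `logDet` set to zero on the null set where `1` is an eigenvalue. -/
def regLogDet (A : Matrix m m ℂ) : ℂ := if (1 - A).det = 0 then 0 else logDet A

open scoped Matrix.Norms.L2Operator in
lemma measurable_regLogDet :
    Measurable fun A : Matrix.unitaryGroup m ℂ => regLogDet (A : Matrix m m ℂ) := by
  have hE : MeasurableSet {A : Matrix.unitaryGroup m ℂ | (1 - (A : Matrix m m ℂ)).det = 0} :=
    measurable_det_one_sub measurable_subtype_coe (measurableSet_singleton 0)
  refine measurable_of_tendsto_metrizable (f := fun l (A : Matrix.unitaryGroup m ℂ) =>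
    if (1 - (A : Matrix m m ℂ)).det = 0 then 0 else
      ((A : Matrix m m ℂ).charpoly.roots.map fun z => Complex.log (1 - radius l * z)).sum)
    (fun l => ?_) (tendsto_pi_nhds.2 fun A => ?_)
  · refine Measurable.ite hE measurable_const ?_
    refine measurable_of_tendsto_metrizable (f := fun M (A : Matrix.unitaryGroup m ℂ) =>
      -(Polynomial.aeval (A : Matrix m m ℂ) (logPoly (radius l) M)).trace)
      (fun M => (measurable_trace_aeval measurable_subtype_coe _).neg)
      (tendsto_pi_nhds.2 fun A => ?_)
    simp only [trace_aeval, ← Multiset.sum_map_neg]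
    refine tendsto_multiset_sum_map fun z hz => ?_
    simpa using (tendsto_eval_logPoly (norm_le_one_of_mem_roots (norm_unitary_le A) hz) l).neg
  · simp only [regLogDet]
    split_ifs with h
    · exact tendsto_const_nhds
    · refine tendsto_multiset_sum_map fun z hz => tendsto_log_one_sub_radius_mul
        (norm_le_one_of_mem_roots (norm_unitary_le A) hz) ?_
      rintro rfl
      exact h ((det_one_sub_eq_zero_iff _).2 hz)

end RegLogDet

lemma regLogDet_congr {m n : Type*} [Fintype m] [DecidableEq m] [Fintype n] [DecidableEq n]
    {A : Matrix m m ℂ} {B : Matrix n n ℂ} (h : A.charpoly = B.charpoly) :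
    regLogDet A = regLogDet B := by
  simp only [regLogDet, det_one_sub_eq_zero_iff, logDet, h]

section Phase

variable {m : Type*} [Fintype m] [DecidableEq m]

/-- The scalar unitary matrix `e^{iφ}`. -/
def phase (φ : ℝ) : unitaryGroup m ℂ :=
  ⟨Complex.exp (φ * Complex.I) • 1, by
    rw [mem_unitaryGroup_iff, star_smul, star_one, smul_mul_smul_comm, mul_one]
    rw [Complex.star_def, Complex.mul_conj, Complex.normSq_eq_norm_sq,
      Complex.norm_exp_ofReal_mul_I]
    simp⟩

lemma coe_phase_mul (φ : ℝ) (A : unitaryGroup m ℂ) :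
    ((phase φ * A : unitaryGroup m ℂ) : Matrix m m ℂ)
      = Complex.exp (φ * Complex.I) • (A : Matrix m m ℂ) := by
  simp [phase]

lemma measurable_phase_mul :
    Measurable fun p : ℝ × unitaryGroup m ℂ => phase p.1 * p.2 := by
  refine Measurable.subtype_mk (measurable_of_entries fun i j => ?_)
  have : ∀ p : ℝ × unitaryGroup m ℂ, ((phase p.1 : unitaryGroup m ℂ) : Matrix m m ℂ) * p.2
      = Complex.exp (p.1 * Complex.I) • (p.2 : Matrix m m ℂ) := fun p => coe_phase_mul _ _
  simp only [this, Matrix.smul_apply, smul_eq_mul]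
  refine Measurable.mul ?_ (measurable_entry (measurable_subtype_coe.comp measurable_snd) i j)
  fun_prop

lemma finite_exp_mul_I_mem {T : Set ℂ} (hT : T.Finite) :
    {φ : ℝ | φ ∈ Set.Ioo 0 1 ∧ Complex.exp (φ * Complex.I) ∈ T}.Finite := by
  refine Set.Finite.of_finite_image (hT.subset ?_ : Set.Finite
    ((fun φ : ℝ => Complex.exp (φ * Complex.I)) '' _)) ?_
  · rintro _ ⟨φ, hφ, rfl⟩
    exact hφ.2
  · intro x hx y hy hxy
    have hpi := Real.pi_gt_three
    have key : ∀ t : ℝ, t ∈ Set.Ioo (0 : ℝ) 1 → Complex.arg (Complex.exp (t * Complex.I)) = t :=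
      fun t ht => by
        rw [Complex.arg_exp_mul_I, toIocMod_eq_self]
        constructor <;> linarith [ht.1, ht.2]
    rw [← key x hx.1, ← key y hy.1]
    exact congrArg Complex.arg hxy

variable {μ : Measure (unitaryGroup m ℂ)} [IsProbabilityMeasure μ] [μ.IsMulLeftInvariant]

lemma measure_eq_zero_of_finite_phase {E : Set (unitaryGroup m ℂ)} (hE : MeasurableSet E)
    (h : ∀ A, {φ : ℝ | φ ∈ Set.Ioo 0 1 ∧ phase φ * A ∈ E}.Finite) : μ E = 0 := by
  set ρ : Measure ℝ := volume.restrict (Set.Ioo 0 1) with hρ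
  have hS : MeasurableSet ((fun p : ℝ × unitaryGroup m ℂ => phase p.1 * p.2) ⁻¹' E) :=
    measurable_phase_mul hE
  have h1 := Measure.prod_apply (μ := ρ) (ν := μ) hS
  have h2 := Measure.prod_apply_symm (μ := ρ) (ν := μ) hS
  have h3 : ∀ φ : ℝ, μ (Prod.mk φ ⁻¹' ((fun p : ℝ × unitaryGroup m ℂ => phase p.1 * p.2) ⁻¹' E))
      = μ E := fun φ => measure_preimage_mul μ (phase φ) E
  have h4 : ∀ A, ρ ((fun φ => (φ, A)) ⁻¹'
      ((fun p : ℝ × unitaryGroup m ℂ => phase p.1 * p.2) ⁻¹' E)) = 0 := fun A => by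
    rw [hρ, Measure.restrict_apply' measurableSet_Ioo]
    refine Set.Finite.measure_zero ((h A).subset ?_) _
    rintro φ ⟨h, h'⟩
    exact ⟨h', h⟩
  rw [h1] at h2
  simp only [h3, h4] at h2
  simpa [hρ] using h2

lemma ae_det_one_sub_ne_zero : ∀ᵐ A : unitaryGroup m ℂ ∂μ, (1 - (A : Matrix m m ℂ)).det ≠ 0 := by
  rw [ae_iff]
  simp only [not_not]
  refine measure_eq_zero_of_finite_phase
    (measurable_det_one_sub measurable_subtype_coe (measurableSet_singleton 0)) fun A => ?_
  refine (finite_exp_mul_I_mem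
    (((A : Matrix m m ℂ).charpoly.roots.map fun l => l⁻¹).toFinset.finite_toSet)).subset ?_
  rintro φ ⟨h, h'⟩
  refine ⟨h, ?_⟩
  simp only [Set.mem_ofPred_eq, coe_phase_mul, det_one_sub_smul, Multiset.prod_eq_zero_iff,
    Multiset.mem_map] at h'
  obtain ⟨l, hl, h0⟩ := h'
  simp only [Finset.mem_coe, Multiset.mem_toFinset, Multiset.mem_map]
  exact ⟨l, hl, inv_eq_of_mul_eq_one_left (sub_eq_zero.1 h0).symm⟩

lemma ae_diag_ne_one (i : m) : ∀ᵐ A : unitaryGroup m ℂ ∂μ, (A : Matrix m m ℂ) i i ≠ 1 := by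
  rw [ae_iff]
  simp only [not_not]
  refine measure_eq_zero_of_finite_phase (measurable_entry measurable_subtype_coe i i
    (measurableSet_singleton 1)) fun A => ?_
  refine (finite_exp_mul_I_mem (Set.finite_singleton ((A : Matrix m m ℂ) i i)⁻¹)).subset ?_
  rintro φ ⟨h, h'⟩
  refine ⟨h, ?_⟩
  simp only [Set.mem_ofPred_eq, coe_phase_mul, Matrix.smul_apply, smul_eq_mul] at h'
  exact (inv_eq_of_mul_eq_one_left h').symm

end Phase

section Recursion

variable {n : Type*} [Fintype n] [DecidableEq n]

/-- The block matrix `1 ⊕ V`. -/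
def cornerEmbed (V : unitaryGroup n ℂ) : unitaryGroup (Unit ⊕ n) ℂ :=
  ⟨fromBlocks 1 0 0 (V : Matrix n n ℂ), by
    rw [mem_unitaryGroup_iff, star_eq_conjTranspose, fromBlocks_conjTranspose, fromBlocks_multiply,
      ← star_eq_conjTranspose (V : Matrix n n ℂ), mem_unitaryGroup_iff.1 V.2]
    simp⟩

lemma measurable_cornerEmbed : Measurable (cornerEmbed (n := n)) := by
  refine Measurable.subtype_mk (measurable_of_entries fun i j => ?_)
  rcases i with i | i <;> rcases j with j | j <;> simp only [fromBlocks_apply₁₁, fromBlocks_apply₁₂,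
    fromBlocks_apply₂₁, fromBlocks_apply₂₂]
  · exact measurable_const
  · exact measurable_const
  · exact measurable_const
  · exact measurable_entry measurable_subtype_coe i j

lemma mul_cornerEmbed_apply (A : unitaryGroup (Unit ⊕ n) ℂ) (V : unitaryGroup n ℂ) (i : Unit ⊕ n) :
    ((A * cornerEmbed V : unitaryGroup (Unit ⊕ n) ℂ) :
      Matrix (Unit ⊕ n) (Unit ⊕ n) ℂ) i (.inl ())
      = (A : Matrix (Unit ⊕ n) (Unit ⊕ n) ℂ) i (.inl ()) := by
  simp [cornerEmbed, mul_apply]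

lemma schurPart_mul_cornerEmbed (A : unitaryGroup (Unit ⊕ n) ℂ) (V : unitaryGroup n ℂ) :
    schurPart ((A * cornerEmbed V : unitaryGroup (Unit ⊕ n) ℂ) :
      Matrix (Unit ⊕ n) (Unit ⊕ n) ℂ)
      = schurPart (A : Matrix (Unit ⊕ n) (Unit ⊕ n) ℂ) * V := by
  ext i j
  simp only [schurPart, of_apply, mul_cornerEmbed_apply, mul_apply (M := of _)]
  simp only [cornerEmbed, UnitaryGroup.mul_val, mul_apply, Fintype.sum_sum_type, fromBlocks_apply₁₂,
    fromBlocks_apply₂₂, Matrix.zero_apply, mul_zero, Finset.sum_const_zero, zero_add, add_mul,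
    Finset.sum_add_distrib, Finset.mul_sum, mul_assoc]

lemma det_one_sub_eq_mul (A : unitaryGroup (Unit ⊕ n) ℂ)
    (ha : (A : Matrix (Unit ⊕ n) (Unit ⊕ n) ℂ) (.inl ()) (.inl ()) ≠ 1) :
    (1 - (A : Matrix (Unit ⊕ n) (Unit ⊕ n) ℂ)).det
      = (1 - (A : Matrix (Unit ⊕ n) (Unit ⊕ n) ℂ) (.inl ()) (.inl ()))
        * (1 - schurPart (A : Matrix (Unit ⊕ n) (Unit ⊕ n) ℂ)).det := by
  have h := det_one_sub_mul_diagonal (A : Matrix (Unit ⊕ n) (Unit ⊕ n) ℂ) ha 1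
  have h1 : (Sum.elim (fun _ => 1) (fun _ => 1) : Unit ⊕ n → ℂ) = fun _ => 1 := by
    ext x; cases x <;> rfl
  rwa [h1, diagonal_one, mul_one, one_smul] at h

lemma regLogDet_eq_add (A : unitaryGroup (Unit ⊕ n) ℂ)
    (ha : (A : Matrix (Unit ⊕ n) (Unit ⊕ n) ℂ) (.inl ()) (.inl ()) ≠ 1)
    (hdet : (1 - schurPart (A : Matrix (Unit ⊕ n) (Unit ⊕ n) ℂ)).det ≠ 0) :
    regLogDet (A : Matrix (Unit ⊕ n) (Unit ⊕ n) ℂ)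
      = Complex.log (1 - (A : Matrix (Unit ⊕ n) (Unit ⊕ n) ℂ) (.inl ()) (.inl ()))
      + regLogDet (schurPart (A : Matrix (Unit ⊕ n) (Unit ⊕ n) ℂ)) := by
  rw [regLogDet, if_neg, logDet_eq_add A ha hdet, regLogDet, if_neg hdet]
  rw [det_one_sub_eq_mul A ha]
  exact mul_ne_zero (sub_ne_zero.2 ha.symm) hdet

lemma integral_regLogDet_eq_mul
    (μ : Measure (unitaryGroup (Unit ⊕ n) ℂ)) [IsProbabilityMeasure μ] [μ.IsMulLeftInvariant]
    (ν : Measure (unitaryGroup n ℂ)) [IsProbabilityMeasure ν] [ν.IsMulLeftInvariant]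
    {h : ℂ → ℂ} (hm : Measurable h) (hb : ∀ z, ‖h z‖ ≤ 1) (hadd : ∀ x y, h (x + y) = h x * h y) :
    ∫ A : unitaryGroup (Unit ⊕ n) ℂ, h (regLogDet (A : Matrix (Unit ⊕ n) (Unit ⊕ n) ℂ)) ∂μ
      = (∫ A : unitaryGroup (Unit ⊕ n) ℂ,
          h (Complex.log (1 - (A : Matrix (Unit ⊕ n) (Unit ⊕ n) ℂ) (.inl ()) (.inl ()))) ∂μ)
        * ∫ V : unitaryGroup n ℂ, h (regLogDet (V : Matrix n n ℂ)) ∂ν := by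
  have hF : Measurable fun p : unitaryGroup n ℂ × unitaryGroup (Unit ⊕ n) ℂ =>
      h (regLogDet ((cornerEmbed p.1 * p.2 : unitaryGroup (Unit ⊕ n) ℂ) :
      Matrix (Unit ⊕ n) (Unit ⊕ n) ℂ)) :=
    hm.comp (measurable_regLogDet.comp
      ((measurable_cornerEmbed.comp measurable_fst).mul measurable_snd))
  have h1 : ∫ A : unitaryGroup (Unit ⊕ n) ℂ, h (regLogDet (A : Matrix (Unit ⊕ n) (Unit ⊕ n) ℂ)) ∂μ
      = ∫ V : unitaryGroup n ℂ, ∫ A : unitaryGroup (Unit ⊕ n) ℂ,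
      h (regLogDet ((cornerEmbed V * A : unitaryGroup (Unit ⊕ n) ℂ) :
      Matrix (Unit ⊕ n) (Unit ⊕ n) ℂ)) ∂μ ∂ν := by
    have : ∀ V : unitaryGroup n ℂ, ∫ A : unitaryGroup (Unit ⊕ n) ℂ,
        h (regLogDet ((cornerEmbed V * A : unitaryGroup (Unit ⊕ n) ℂ) :
      Matrix (Unit ⊕ n) (Unit ⊕ n) ℂ)) ∂μ
        = ∫ A : unitaryGroup (Unit ⊕ n) ℂ, h (regLogDet (A : Matrix (Unit ⊕ n) (Unit ⊕ n) ℂ)) ∂μ := fun V =>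
      integral_mul_left_eq_self (μ := μ)
        (fun A : unitaryGroup (Unit ⊕ n) ℂ => h (regLogDet (A : Matrix (Unit ⊕ n) (Unit ⊕ n) ℂ)))
        (cornerEmbed V)
    simp only [this, integral_const, probReal_univ, one_smul]
  rw [h1, integral_integral_swap, ← integral_mul_const]
  · refine integral_congr_ae ?_
    filter_upwards [ae_diag_ne_one (μ := μ) (.inl ())] with A hA
    set W : unitaryGroup n ℂ :=
      ⟨schurPart (A : Matrix (Unit ⊕ n) (Unit ⊕ n) ℂ), schurPart_mem_unitaryGroup A hA⟩
    rw [← integral_mul_left_eq_self (μ := ν)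
      (fun V : unitaryGroup n ℂ => h (regLogDet (V : Matrix n n ℂ))) W, ← integral_const_mul]
    refine integral_congr_ae ?_
    have hW : ∀ᵐ V : unitaryGroup n ℂ ∂ν, (1 - ((W * V : unitaryGroup n ℂ) : Matrix n n ℂ)).det ≠ 0 :=
      (measurePreserving_mul_left ν W).quasiMeasurePreserving.ae ae_det_one_sub_ne_zero
    filter_upwards [hW] with V hV
    have hS : schurPart ((A * cornerEmbed V : unitaryGroup (Unit ⊕ n) ℂ) :
      Matrix (Unit ⊕ n) (Unit ⊕ n) ℂ)
      = ((W * V : unitaryGroup n ℂ) : Matrix n n ℂ) := schurPart_mul_cornerEmbed A V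
    rw [regLogDet_congr (B := ((A * cornerEmbed V : unitaryGroup (Unit ⊕ n) ℂ) :
      Matrix (Unit ⊕ n) (Unit ⊕ n) ℂ)),
      regLogDet_eq_add _ (by rwa [mul_cornerEmbed_apply]) (by rwa [hS]), hS, hadd,
      mul_cornerEmbed_apply]
    simp only [UnitaryGroup.mul_val]
    exact charpoly_mul_comm _ _
  · exact Integrable.of_bound hF.aestronglyMeasurable 1 (ae_of_all _ fun p => hb _)

end Recursion

section Moments

variable {m : Type*} [Fintype m] [DecidableEq m]

lemma norm_entry_le_one (A : unitaryGroup m ℂ) (i j : m) : ‖(A : Matrix m m ℂ) i j‖ ≤ 1 :=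
  entry_norm_bound_of_unitary A.2 i j

lemma measurable_unitary_entry (i j : m) :
    Measurable fun A : unitaryGroup m ℂ => (A : Matrix m m ℂ) i j :=
  measurable_entry measurable_subtype_coe i j

lemma sum_norm_sq_col (A : unitaryGroup m ℂ) (i : m) :
    ∑ j, ‖(A : Matrix m m ℂ) j i‖ ^ 2 = 1 := by
  have h := congrFun (congrFun (mem_unitaryGroup_iff'.1 A.2) i) i
  rw [mul_apply, one_apply_eq] at h
  rw [← Complex.ofReal_inj]
  push_cast
  rw [← h]
  refine Finset.sum_congr rfl fun j _ => ?_
  rw [star_apply, Complex.star_def, Complex.conj_mul']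

/-- Householder reflections. -/
lemma exists_unitary_reflection (w : m → ℂ) (c : ℂ) (hc : star c = c)
    (hw : c * (star w ⬝ᵥ w) = 2) :
    ∃ H : unitaryGroup m ℂ, (H : Matrix m m ℂ) = 1 - c • vecMulVec w (star w) := by
  refine ⟨⟨1 - c • vecMulVec w (star w), ?_⟩, rfl⟩
  rw [mem_unitaryGroup_iff]
  have h1 : star (1 - c • vecMulVec w (star w)) = 1 - c • vecMulVec w (star w) := by
    rw [star_sub, star_one, star_smul, hc, star_eq_conjTranspose, conjTranspose_vecMulVec,
      star_star]
  rw [h1, sub_mul, mul_sub, mul_sub, mul_one, one_mul, mul_one, smul_mul_smul_comm, vecMulVec_mul_vecMulVec]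
  have h2 : (c * c) • vecMulVec w ((star w ⬝ᵥ w) • star w) = (2 * c) • vecMulVec w (star w) := by
    rw [← hw]
    ext x y
    simp only [Matrix.smul_apply, vecMulVec_apply, Pi.smul_apply, smul_eq_mul]
    ring
  rw [h2, two_mul, add_smul]
  abel

lemma exists_unitary_mix {i j : m} (hij : i ≠ j) (t : ℂ) :
    ∃ H : unitaryGroup m ℂ, ∀ (A : unitaryGroup m ℂ) (l : m),
      ((H * A : unitaryGroup m ℂ) : Matrix m m ℂ) i l = (A : Matrix m m ℂ) i l
        - 2 / (1 + ‖t‖ ^ 2) * ((A : Matrix m m ℂ) i l + star t * (A : Matrix m m ℂ) j l) := by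
  have hpos : (1 + (‖t‖ : ℂ) ^ 2) ≠ 0 := by
    rw [← Complex.ofReal_pow, ← Complex.ofReal_one, ← Complex.ofReal_add, Complex.ofReal_ne_zero]
    positivity
  have hd : ∀ x : m → ℂ, star (Pi.single i 1 + Pi.single j t : m → ℂ) ⬝ᵥ x
      = x i + star t * x j := fun x => by
    rw [star_add, add_dotProduct, ← Pi.single_star, ← Pi.single_star, single_dotProduct,
      single_dotProduct, star_one, one_mul]
  obtain ⟨H, hH⟩ := exists_unitary_reflection (Pi.single i 1 + Pi.single j t : m → ℂ)
    (2 / (1 + (‖t‖ : ℂ) ^ 2)) (by simp) (by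
      rw [hd]
      simp only [Pi.add_apply, Pi.single_eq_same, Pi.single_eq_of_ne hij,
        Pi.single_eq_of_ne hij.symm, add_zero, zero_add, Complex.star_def, Complex.conj_mul']
      field_simp)
  refine ⟨H, fun A l => ?_⟩
  rw [UnitaryGroup.mul_val, hH, sub_mul, one_mul, Matrix.sub_apply, smul_mul, Matrix.smul_apply,
    vecMulVec_mul, vecMulVec_apply, smul_eq_mul]
  have : (star (Pi.single i 1 + Pi.single j t : m → ℂ) ᵥ* (A : Matrix m m ℂ)) l
      = (A : Matrix m m ℂ) i l + star t * (A : Matrix m m ℂ) j l :=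
    hd fun x => (A : Matrix m m ℂ) x l
  rw [this, Pi.add_apply, Pi.single_eq_same, Pi.single_eq_of_ne hij]
  ring

variable {μ : Measure (unitaryGroup m ℂ)} [IsProbabilityMeasure μ] [μ.IsMulLeftInvariant]

lemma integral_pow_mul_conj_pow (i j : m) {p q : ℕ} (hpq : p ≠ q) :
    ∫ A : unitaryGroup m ℂ, (A : Matrix m m ℂ) i j ^ p * star ((A : Matrix m m ℂ) i j) ^ q ∂μ
      = 0 := by
  set f : unitaryGroup m ℂ → ℂ := fun A =>
    (A : Matrix m m ℂ) i j ^ p * star ((A : Matrix m m ℂ) i j) ^ q with hf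
  set φ : ℝ := Real.pi / ((p : ℝ) - q) with hφ
  have hne : (p : ℂ) - q ≠ 0 := sub_ne_zero.2 (by exact_mod_cast hpq)
  have h1 : ∀ A, f (phase φ * A) = -f A := fun A => by
    have h2 : Complex.exp (φ * Complex.I) ^ p * star (Complex.exp (φ * Complex.I)) ^ q = -1 := by
      rw [Complex.star_def, ← Complex.exp_conj, ← Complex.exp_nat_mul, ← Complex.exp_nat_mul,
        ← Complex.exp_add, ← Complex.exp_pi_mul_I]
      congr 1
      rw [map_mul, Complex.conj_ofReal, Complex.conj_I, hφ]
      push_cast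
      field_simp
      ring
    simp only [hf, coe_phase_mul, Matrix.smul_apply, smul_eq_mul, star_mul', mul_pow]
    linear_combination ((A : Matrix m m ℂ) i j ^ p * star ((A : Matrix m m ℂ) i j) ^ q) * h2
  have h3 := integral_mul_left_eq_self (μ := μ) f (phase φ)
  simp only [h1, integral_neg] at h3
  have h4 : (2 : ℂ) * ∫ A, f A ∂μ = 0 := by linear_combination -h3
  simpa using h4

lemma integrable_of_measurable_of_bound {E : Type*} [NormedAddCommGroup E] [MeasurableSpace E]
    [BorelSpace E] [SecondCountableTopology E]
    {f : unitaryGroup m ℂ → E} (hf : Measurable f) {C : ℝ}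
    (hC : ∀ A, ‖f A‖ ≤ C) : Integrable f μ :=
  Integrable.of_bound hf.aestronglyMeasurable C (ae_of_all _ hC)

lemma integrable_norm_pow_mul (i j k l : m) (p q : ℕ) : Integrable (fun A : unitaryGroup m ℂ =>
    ‖(A : Matrix m m ℂ) i j‖ ^ p * ‖(A : Matrix m m ℂ) k l‖ ^ q) μ := by
  refine integrable_of_measurable_of_bound (C := 1) ?_ fun A => ?_
  · exact ((measurable_unitary_entry i j).norm.pow_const p).mul
      ((measurable_unitary_entry k l).norm.pow_const q)
  · rw [Real.norm_of_nonneg (by positivity)]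
    exact mul_le_one₀ (pow_le_one₀ (norm_nonneg _) (norm_entry_le_one A i j)) (by positivity)
      (pow_le_one₀ (norm_nonneg _) (norm_entry_le_one A k l))

lemma integrable_norm_pow (i j : m) (p : ℕ) : Integrable (fun A : unitaryGroup m ℂ =>
    ‖(A : Matrix m m ℂ) i j‖ ^ p) μ := by
  simpa using integrable_norm_pow_mul (μ := μ) i j i j p 0

lemma integral_norm_pow_row_eq (i j l : m) (p : ℕ) :
    ∫ A : unitaryGroup m ℂ, ‖(A : Matrix m m ℂ) j l‖ ^ p ∂μ
      = ∫ A : unitaryGroup m ℂ, ‖(A : Matrix m m ℂ) i l‖ ^ p ∂μ := by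
  rcases eq_or_ne i j with rfl | hij
  · rfl
  obtain ⟨H, hH⟩ := exists_unitary_mix hij (-1)
  rw [← integral_mul_left_eq_self (μ := μ)
    (fun A : unitaryGroup m ℂ => ‖(A : Matrix m m ℂ) i l‖ ^ p) H]
  simp only [hH]
  norm_num

lemma integral_norm_sq (i l : m) :
    Fintype.card m * ∫ A : unitaryGroup m ℂ, ‖(A : Matrix m m ℂ) i l‖ ^ 2 ∂μ = 1 := by
  have h : ∑ j, ∫ A : unitaryGroup m ℂ, ‖(A : Matrix m m ℂ) j l‖ ^ 2 ∂μ = 1 := by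
    rw [← integral_finsetSum _ fun j _ => integrable_norm_pow j l 2]
    simp only [sum_norm_sq_col, integral_const, probReal_univ, one_smul]
  simp only [integral_norm_pow_row_eq i _ l 2] at h
  simpa using h

lemma sum_norm_mix_pow_four (u v : ℂ) :
    ‖(3 / 5 : ℂ) * u - 4 / 5 * v‖ ^ 4 + ‖(3 / 5 : ℂ) * u + 4 / 5 * v‖ ^ 4
      + ‖(3 / 5 : ℂ) * u - 4 / 5 * (Complex.I * v)‖ ^ 4
      + ‖(3 / 5 : ℂ) * u + 4 / 5 * (Complex.I * v)‖ ^ 4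
      = 4 * ((3 / 5) ^ 4 * ‖u‖ ^ 4 + (4 / 5) ^ 4 * ‖v‖ ^ 4
        + 4 * ((3 / 5) ^ 2 * (4 / 5) ^ 2) * (‖u‖ ^ 2 * ‖v‖ ^ 2)) := by
  have h4 : ∀ z : ℂ, ‖z‖ ^ 4 = (z.re ^ 2 + z.im ^ 2) ^ 2 := fun z => by
    rw [← Complex.sq_norm_sub_sq_re z]; ring
  have h2 : ∀ z : ℂ, ‖z‖ ^ 2 = z.re ^ 2 + z.im ^ 2 := fun z => by
    rw [← Complex.sq_norm_sub_sq_re z]; ring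
  have e1 : ∀ z : ℂ, ((3 / 5 : ℂ) * z).re = 3 / 5 * z.re := fun z => by
    rw [show (3 / 5 : ℂ) = ((3 / 5 : ℝ) : ℂ) by norm_num, Complex.re_ofReal_mul]
  have e2 : ∀ z : ℂ, ((3 / 5 : ℂ) * z).im = 3 / 5 * z.im := fun z => by
    rw [show (3 / 5 : ℂ) = ((3 / 5 : ℝ) : ℂ) by norm_num, Complex.im_ofReal_mul]
  have e3 : ∀ z : ℂ, ((4 / 5 : ℂ) * z).re = 4 / 5 * z.re := fun z => by
    rw [show (4 / 5 : ℂ) = ((4 / 5 : ℝ) : ℂ) by norm_num, Complex.re_ofReal_mul]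
  have e4 : ∀ z : ℂ, ((4 / 5 : ℂ) * z).im = 4 / 5 * z.im := fun z => by
    rw [show (4 / 5 : ℂ) = ((4 / 5 : ℝ) : ℂ) by norm_num, Complex.im_ofReal_mul]
  simp only [h4, h2, Complex.sub_re, Complex.sub_im, Complex.add_re, Complex.add_im, e1, e2, e3,
    e4, Complex.I_mul_re, Complex.I_mul_im]
  ring

lemma integral_add₃ {Ω : Type*} [MeasurableSpace Ω] {P : Measure Ω} {f g h : Ω → ℝ}
    (hf : Integrable f P) (hg : Integrable g P) (hh : Integrable h P) :
    ∫ x, f x + g x + h x ∂P = ∫ x, f x ∂P + ∫ x, g x ∂P + ∫ x, h x ∂P := by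
  rw [← integral_add hf hg]
  exact integral_add (hf.add hg) hh

lemma integral_add₄ {Ω : Type*} [MeasurableSpace Ω] {P : Measure Ω} {f g h k : Ω → ℝ}
    (hf : Integrable f P) (hg : Integrable g P) (hh : Integrable h P) (hk : Integrable k P) :
    ∫ x, f x + g x + h x + k x ∂P
      = ∫ x, f x ∂P + ∫ x, g x ∂P + ∫ x, h x ∂P + ∫ x, k x ∂P := by
  rw [← integral_add₃ hf hg hh]
  exact integral_add ((hf.add hg).add hh) hk

lemma integral_norm_sq_mul_norm_sq {i j : m} (hij : i ≠ j) (l : m) :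
    2 * ∫ A : unitaryGroup m ℂ, ‖(A : Matrix m m ℂ) i l‖ ^ 2 * ‖(A : Matrix m m ℂ) j l‖ ^ 2 ∂μ
      = ∫ A : unitaryGroup m ℂ, ‖(A : Matrix m m ℂ) i l‖ ^ 4 ∂μ := by
  have key : ∀ ζ : ℂ, ‖ζ‖ = 1 →
      ∫ A : unitaryGroup m ℂ, ‖(3 / 5 : ℂ) * (A : Matrix m m ℂ) i l
        - 4 / 5 * (star ζ * (A : Matrix m m ℂ) j l)‖ ^ 4 ∂μ
        = ∫ A : unitaryGroup m ℂ, ‖(A : Matrix m m ℂ) i l‖ ^ 4 ∂μ := fun ζ hζ => by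
    obtain ⟨H, hH⟩ := exists_unitary_mix hij (2 * ζ)
    rw [← integral_mul_left_eq_self (μ := μ)
      (fun A : unitaryGroup m ℂ => ‖(A : Matrix m m ℂ) i l‖ ^ 4) H]
    simp only [hH]
    congr 1
    ext A
    congr 2
    rw [norm_mul, hζ, star_mul']
    norm_num
    ring
  have hInt : ∀ ζ : ℂ, ‖ζ‖ = 1 → Integrable (fun A : unitaryGroup m ℂ =>
      ‖(3 / 5 : ℂ) * (A : Matrix m m ℂ) i l
        - 4 / 5 * (star ζ * (A : Matrix m m ℂ) j l)‖ ^ 4) μ := fun ζ hζ => by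
    refine integrable_of_measurable_of_bound (C := 16) ?_ fun A => ?_
    · exact (((measurable_unitary_entry i l).const_mul _).sub
        (((measurable_unitary_entry j l).const_mul _).const_mul _)).norm.pow_const 4
    · rw [Real.norm_of_nonneg (by positivity), show (16 : ℝ) = 2 ^ 4 by norm_num]
      refine pow_le_pow_left₀ (norm_nonneg _) ((norm_sub_le _ _).trans ?_) 4
      rw [norm_mul, norm_mul, norm_mul, norm_star, hζ]
      norm_num
      linarith [norm_entry_le_one A i l, norm_entry_le_one A j l]
  have k1 := key 1 (by simp)
  have k2 := key (-1) (by simp)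
  have k3 := key Complex.I (by simp)
  have k4 := key (-Complex.I) (by simp)
  have hsum : ∀ A : unitaryGroup m ℂ, _ := fun A =>
    sum_norm_mix_pow_four ((A : Matrix m m ℂ) i l) ((A : Matrix m m ℂ) j l)
  have hs := integral_congr_ae (μ := μ) (ae_of_all μ hsum)
  have i1 := hInt 1 (by simp)
  have i2 := hInt (-1) (by simp)
  have i3 := hInt Complex.I (by simp)
  have i4 := hInt (-Complex.I) (by simp)
  simp only [star_one, star_neg, one_mul, neg_mul, mul_neg, sub_neg_eq_add, Complex.star_def,
    Complex.conj_I, ← sub_eq_add_neg] at k1 k2 k3 k4 i1 i2 i3 i4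
  rw [integral_add₄ i1 i2 i4 i3, k1, k2, k3, k4, integral_const_mul, integral_add₃
      ((integrable_norm_pow i l 4).const_mul _) ((integrable_norm_pow j l 4).const_mul _)
      ((integrable_norm_pow_mul i l j l 2 2).const_mul _), integral_const_mul, integral_const_mul, integral_const_mul,
    integral_norm_pow_row_eq i j l 4] at hs
  linarith

lemma integral_norm_pow_four (i l : m) :
    Fintype.card m * (Fintype.card m + 1)
      * ∫ A : unitaryGroup m ℂ, ‖(A : Matrix m m ℂ) i l‖ ^ 4 ∂μ = 2 := by
  set a := ∫ A : unitaryGroup m ℂ, ‖(A : Matrix m m ℂ) i l‖ ^ 4 ∂μ with ha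
  have h : ∑ j, ∫ A : unitaryGroup m ℂ,
      ‖(A : Matrix m m ℂ) i l‖ ^ 2 * ‖(A : Matrix m m ℂ) j l‖ ^ 2 ∂μ
      = ∫ A : unitaryGroup m ℂ, ‖(A : Matrix m m ℂ) i l‖ ^ 2 ∂μ := by
    rw [← integral_finsetSum _ fun j _ => integrable_norm_pow_mul i l j l 2 2]
    simp only [← Finset.mul_sum, sum_norm_sq_col, mul_one]
  have h' : ∀ j ∈ Finset.univ.erase i, ∫ A : unitaryGroup m ℂ,
      ‖(A : Matrix m m ℂ) i l‖ ^ 2 * ‖(A : Matrix m m ℂ) j l‖ ^ 2 ∂μ = a / 2 := fun j hj => by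
    rw [ha, ← integral_norm_sq_mul_norm_sq (Finset.ne_of_mem_erase hj).symm l]
    ring
  rw [← Finset.add_sum_erase _ _ (Finset.mem_univ i), Finset.sum_congr rfl h', Finset.sum_const,
    Finset.card_erase_of_mem (Finset.mem_univ i), Finset.card_univ, nsmul_eq_mul,
    Nat.cast_sub (Fintype.card_pos_iff.2 ⟨i⟩)] at h
  have h4 : ∫ A : unitaryGroup m ℂ,
      ‖(A : Matrix m m ℂ) i l‖ ^ 2 * ‖(A : Matrix m m ℂ) i l‖ ^ 2 ∂μ = a := by
    simp only [← pow_add, ha]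
  rw [h4] at h
  have h2 := integral_norm_sq (μ := μ) i l
  rw [← h] at h2
  push_cast at h2
  linarith

end Moments

section Taylor

lemma norm_exp_mul_I_sub_le (x : ℝ) :
    ‖Complex.exp (x * Complex.I) - 1 - x * Complex.I + (x : ℂ) ^ 2 / 2‖ ≤ 4 * |x| ^ 3 ∧
    ‖Complex.exp (x * Complex.I) - 1 - x * Complex.I + (x : ℂ) ^ 2 / 2‖ ≤ 4 * |x| ^ 2 := by
  have h0 := abs_nonneg x
  have hnorm : ‖(x : ℂ) * Complex.I‖ = |x| := by simp
  rcases le_total |x| 1 with h | h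
  · have h1 := Complex.exp_bound (x := x * Complex.I) (by rwa [hnorm]) (n := 3) (by norm_num)
    rw [hnorm] at h1
    have h2 : Complex.exp (x * Complex.I) - ∑ k ∈ Finset.range 3, (x * Complex.I) ^ k / k.factorial
        = Complex.exp (x * Complex.I) - 1 - x * Complex.I + (x : ℂ) ^ 2 / 2 := by
      simp only [Finset.sum_range_succ, Finset.sum_range_zero, mul_pow, Complex.I_sq]
      norm_num [Nat.factorial]
      ring
    rw [h2] at h1
    norm_num [Nat.factorial] at h1
    have h3 : |x| ^ 3 ≤ |x| ^ 2 := pow_le_pow_of_le_one h0 h (by norm_num)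
    have h4 : 0 ≤ |x| ^ 3 := by positivity
    constructor <;> linarith
  · have h1 : ‖Complex.exp (x * Complex.I) - 1 - x * Complex.I + (x : ℂ) ^ 2 / 2‖
        ≤ 1 + 1 + |x| + |x| ^ 2 / 2 := by
      refine (norm_add_le _ _).trans (add_le_add ((norm_sub_le _ _).trans
        (add_le_add ((norm_sub_le _ _).trans (add_le_add ?_ ?_)) hnorm.le)) ?_)
      · rw [Complex.norm_exp_ofReal_mul_I]
      · simp
      · simp
    have h3 : |x| ^ 2 ≤ |x| ^ 3 := pow_le_pow_right₀ h (by norm_num)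
    constructor <;> nlinarith

lemma norm_exp_mul_I_sub_le_of_add (x y z : ℝ) (h : x = y + z) :
    ‖Complex.exp (x * Complex.I) - 1 - x * Complex.I + (x : ℂ) ^ 2 / 2‖
      ≤ 32 * (|y| ^ 3 + |z| ^ 2) := by
  obtain ⟨h3, h2⟩ := norm_exp_mul_I_sub_le x
  have hx : |x| ≤ |y| + |z| := h ▸ abs_add_le y z
  have hy : 0 ≤ |y| ^ 3 := by positivity
  have hz : 0 ≤ |z| ^ 2 := by positivity
  rcases le_total |z| |y| with hzy | hzy
  · have : |x| ^ 3 ≤ (2 * |y|) ^ 3 := pow_le_pow_left₀ (abs_nonneg x) (by linarith) 3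
    rw [mul_pow] at this
    linarith
  · have : |x| ^ 2 ≤ (2 * |z|) ^ 2 := pow_le_pow_left₀ (abs_nonneg x) (by linarith) 2
    rw [mul_pow] at this
    linarith

end Taylor

section CharFunExpansion

variable {Ω : Type*} [MeasurableSpace Ω] {P : Measure Ω} [IsProbabilityMeasure P]

lemma norm_charFun_sub_le {X Y Z : Ω → ℂ} (hY : Measurable Y) (hZ : Measurable Z)
    {C : ℝ} (hYC : ∀ ω, ‖Y ω‖ ≤ C) (hZC : ∀ ω, ‖Z ω‖ ≤ C) (hXYZ : ∀ ω, X ω = Z ω + Y ω)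
    (h1 : ∫ ω, X ω ∂P = 0) (h2 : ∫ ω, X ω ^ 2 ∂P = 0) (η : ℂ) :
    ‖(∫ ω, Complex.exp ((inner ℝ (X ω) η : ℝ) * Complex.I) ∂P)
        - (1 - ((‖η‖ ^ 2 * (∫ ω, ‖X ω‖ ^ 2 ∂P) / 4 : ℝ) : ℂ))‖
      ≤ 32 * (‖η‖ ^ 3 * (∫ ω, ‖Z ω‖ ^ 3 ∂P) + ‖η‖ ^ 2 * ∫ ω, ‖Y ω‖ ^ 2 ∂P) := by
  have hX : Measurable X := by
    rw [show X = fun ω => Z ω + Y ω from funext hXYZ]; exact hZ.add hY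
  have hXC : ∀ ω, ‖X ω‖ ≤ C + C := fun ω => by
    rw [hXYZ]; exact (norm_add_le _ _).trans (add_le_add (hZC ω) (hYC ω))
  have iX : Integrable X P := Integrable.of_bound hX.aestronglyMeasurable _ (ae_of_all _ hXC)
  have iX2 : Integrable (fun ω => X ω ^ 2) P := by
    refine Integrable.of_bound (hX.pow_const 2).aestronglyMeasurable ((C + C) ^ 2)
      (ae_of_all _ fun ω => ?_)
    rw [norm_pow]
    exact pow_le_pow_left₀ (norm_nonneg _) (hXC ω) 2
  have iN : ∀ {W : Ω → ℂ} {D : ℝ}, Measurable W → (∀ ω, ‖W ω‖ ≤ D) → ∀ k : ℕ,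
      Integrable (fun ω => ‖W ω‖ ^ k) P := fun {W D} hW hD k => by
    refine Integrable.of_bound (hW.norm.pow_const k).aestronglyMeasurable (D ^ k)
      (ae_of_all _ fun ω => ?_)
    rw [norm_pow, norm_norm]
    exact pow_le_pow_left₀ (norm_nonneg _) (hD ω) k
  set x : Ω → ℝ := fun ω => inner ℝ (X ω) η with hx
  have hxm : Measurable x := (hX.inner_const (𝕜 := ℝ))
  have ix : Integrable x P := iX.inner_const (𝕜 := ℝ) η
  have e1 : ∫ ω, x ω ∂P = 0 := by
    simp only [hx, real_inner_comm η, integral_inner iX]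
    simp [h1]
  have hsq : ∀ ω, x ω ^ 2 = ‖η‖ ^ 2 / 2 * ‖X ω‖ ^ 2 + 2⁻¹ * inner ℝ (X ω ^ 2) (η ^ 2) := fun ω => by
    simp only [hx, Complex.sq_norm]
    simp only [Complex.inner, Complex.normSq_apply, sq, Complex.mul_re,
      Complex.mul_im, Complex.conj_re, Complex.conj_im]
    ring
  have isq : Integrable (fun ω => x ω ^ 2) P := by
    simp only [hsq]
    exact ((iN hX hXC 2).const_mul _).add ((iX2.inner_const (𝕜 := ℝ) (η ^ 2)).const_mul _)
  have e2 : ∫ ω, x ω ^ 2 ∂P = ‖η‖ ^ 2 / 2 * ∫ ω, ‖X ω‖ ^ 2 ∂P := by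
    simp only [hsq]
    rw [integral_add ((iN hX hXC 2).const_mul _)
      ((iX2.inner_const (𝕜 := ℝ) (η ^ 2)).const_mul _), integral_const_mul, integral_const_mul]
    have : ∫ ω, inner ℝ (X ω ^ 2) (η ^ 2) ∂P = 0 := by
      simp only [real_inner_comm (η ^ 2), integral_inner iX2, h2, inner_zero_right]
    rw [this, mul_zero, add_zero]
  have ie : Integrable (fun ω => Complex.exp (x ω * Complex.I)) P := by
    refine Integrable.of_bound (Measurable.aestronglyMeasurable (by fun_prop)) 1
      (ae_of_all _ fun ω => ?_)
    rw [Complex.norm_exp_ofReal_mul_I]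
  have key : (∫ ω, Complex.exp (x ω * Complex.I) ∂P)
        - (1 - ((‖η‖ ^ 2 * (∫ ω, ‖X ω‖ ^ 2 ∂P) / 4 : ℝ) : ℂ))
      = ∫ ω, (Complex.exp (x ω * Complex.I) - 1 - x ω * Complex.I + (x ω : ℂ) ^ 2 / 2) ∂P := by
    have isqC : Integrable (fun ω => (x ω : ℂ) ^ 2 / 2) P := by
      have := (isq.ofReal (𝕜 := ℂ)).div_const 2
      simpa using this
    have i1 : Integrable (fun ω => Complex.exp (x ω * Complex.I) - 1) P :=
      ie.sub (integrable_const _)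
    have ixC : Integrable (fun ω => (x ω : ℂ) * Complex.I) P := ix.ofReal.mul_const _
    have i2 : Integrable (fun ω => Complex.exp (x ω * Complex.I) - 1 - x ω * Complex.I) P :=
      i1.sub ixC
    rw [integral_add i2 isqC, integral_sub i1 ixC, integral_sub ie (integrable_const _),
      integral_mul_const, integral_div]
    have e1' : ∫ ω, (x ω : ℂ) ∂P = 0 := by rw [integral_complex_ofReal, e1]; simp
    have e2' : ∫ ω, (x ω : ℂ) ^ 2 ∂P = ((‖η‖ ^ 2 / 2 * ∫ ω, ‖X ω‖ ^ 2 ∂P : ℝ) : ℂ) := by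
      rw [← e2, ← integral_complex_ofReal]; simp
    rw [e1', e2']
    simp only [integral_const, probReal_univ, one_smul]
    push_cast
    ring
  rw [key]
  have hb : ∀ ω, ‖Complex.exp (x ω * Complex.I) - 1 - x ω * Complex.I + (x ω : ℂ) ^ 2 / 2‖
      ≤ 32 * (‖η‖ ^ 3 * ‖Z ω‖ ^ 3 + ‖η‖ ^ 2 * ‖Y ω‖ ^ 2) := fun ω => by
    refine (norm_exp_mul_I_sub_le_of_add (x ω) (inner ℝ (Z ω) η) (inner ℝ (Y ω) η) ?_).trans ?_
    · simp only [hx, hXYZ, inner_add_left]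
    · have hz := abs_real_inner_le_norm (Z ω) η
      have hy := abs_real_inner_le_norm (Y ω) η
      have hz3 := pow_le_pow_left₀ (abs_nonneg _) hz 3
      have hy2 := pow_le_pow_left₀ (abs_nonneg _) hy 2
      rw [mul_pow] at hz3 hy2
      linarith
  refine (norm_integral_le_of_norm_le ?_ (ae_of_all _ hb)).trans (le_of_eq ?_)
  · exact (((iN hZ hZC 3).const_mul _).add ((iN hY hYC 2).const_mul _)).const_mul _
  · rw [integral_const_mul, integral_add ((iN hZ hZC 3).const_mul _) ((iN hY hYC 2).const_mul _),
      integral_const_mul, integral_const_mul]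

lemma integrable_pow_mul_star_pow {α : Ω → ℂ} (hα : Measurable α) (hα1 : ∀ ω, ‖α ω‖ ≤ 1)
    (p q : ℕ) :
    Integrable (fun ω => α ω ^ p * star (α ω) ^ q) P := by
  refine Integrable.of_bound (Measurable.aestronglyMeasurable ?_) 1 (ae_of_all _ fun ω => ?_)
  · exact (hα.pow_const p).mul
      ((Complex.continuous_conj.measurable.comp hα).pow_const q)
  · rw [norm_mul, norm_pow, norm_pow, norm_star]
    exact mul_le_one₀ (pow_le_one₀ (norm_nonneg _) (hα1 ω)) (by positivity)
      (pow_le_one₀ (norm_nonneg _) (hα1 ω))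

lemma integrable_norm_pow' {α : Ω → ℂ} (hα : Measurable α) (hα1 : ∀ ω, ‖α ω‖ ≤ 1)
    (p : ℕ) : Integrable (fun ω => ‖α ω‖ ^ p) P := by
  refine Integrable.of_bound (hα.norm.pow_const p).aestronglyMeasurable 1
    (ae_of_all _ fun ω => ?_)
  rw [norm_pow, norm_norm]
  exact pow_le_one₀ (norm_nonneg _) (hα1 ω)

lemma integral_sum_mul_pow {α : Ω → ℂ} (hα : Measurable α) (hα1 : ∀ ω, ‖α ω‖ ≤ 1)
    (hmom : ∀ p q : ℕ, p ≠ q → ∫ ω, α ω ^ p * star (α ω) ^ q ∂P = 0)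
    (s : Finset ℕ) (hs : 0 ∉ s) (c : ℕ → ℂ) :
    ∫ ω, ∑ n ∈ s, c n * α ω ^ n ∂P = 0 := by
  have hi : ∀ n, Integrable (fun ω => α ω ^ n) P := fun n => by
    simpa using integrable_pow_mul_star_pow (P := P) hα hα1 n 0
  rw [integral_finsetSum _ fun n _ => (hi n).const_mul _]
  refine Finset.sum_eq_zero fun n hn => ?_
  have := hmom n 0 (fun h => hs (h ▸ hn))
  simp only [pow_zero, mul_one] at this
  rw [integral_const_mul, this, mul_zero]

lemma integral_sum_mul_pow_sq {α : Ω → ℂ} (hα : Measurable α) (hα1 : ∀ ω, ‖α ω‖ ≤ 1)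
    (hmom : ∀ p q : ℕ, p ≠ q → ∫ ω, α ω ^ p * star (α ω) ^ q ∂P = 0)
    (s : Finset ℕ) (hs : 0 ∉ s) (c : ℕ → ℂ) :
    ∫ ω, (∑ n ∈ s, c n * α ω ^ n) ^ 2 ∂P = 0 := by
  have hi : ∀ n, Integrable (fun ω => α ω ^ n) P := fun n => by
    simpa using integrable_pow_mul_star_pow (P := P) hα hα1 n 0
  have : ∀ ω, (∑ n ∈ s, c n * α ω ^ n) ^ 2 = ∑ n ∈ s, ∑ k ∈ s, (c n * c k) * α ω ^ (n + k) :=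
    fun ω => by
      rw [sq, Finset.sum_mul_sum]
      exact Finset.sum_congr rfl fun n _ => Finset.sum_congr rfl fun k _ => by ring
  simp only [this]
  rw [integral_finsetSum _ fun n _ => integrable_finsetSum _ fun k _ => (hi _).const_mul _]
  refine Finset.sum_eq_zero fun n hn => ?_
  rw [integral_finsetSum _ fun k _ => (hi _).const_mul _]
  refine Finset.sum_eq_zero fun k _ => ?_
  have hn0 : n ≠ 0 := fun h => hs (h ▸ hn)
  have := hmom (n + k) 0 (by omega)
  simp only [pow_zero, mul_one] at this
  rw [integral_const_mul, this, mul_zero]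

lemma integral_norm_sq_sum_mul_pow {α : Ω → ℂ} (hα : Measurable α) (hα1 : ∀ ω, ‖α ω‖ ≤ 1)
    (hmom : ∀ p q : ℕ, p ≠ q → ∫ ω, α ω ^ p * star (α ω) ^ q ∂P = 0)
    (s : Finset ℕ) (c : ℕ → ℂ) :
    ∫ ω, ‖∑ n ∈ s, c n * α ω ^ n‖ ^ 2 ∂P = ∑ n ∈ s, ‖c n‖ ^ 2 * ∫ ω, ‖α ω‖ ^ (2 * n) ∂P := by
  rw [← Complex.ofReal_inj, ← integral_complex_ofReal]
  have : ∀ ω, ((‖∑ n ∈ s, c n * α ω ^ n‖ ^ 2 : ℝ) : ℂ)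
      = ∑ n ∈ s, ∑ k ∈ s, (c n * star (c k)) * (α ω ^ n * star (α ω) ^ k) := fun ω => by
    rw [Complex.ofReal_pow, ← Complex.mul_conj', map_sum, Finset.sum_mul_sum]
    refine Finset.sum_congr rfl fun n _ => Finset.sum_congr rfl fun k _ => ?_
    simp only [map_mul, map_pow, Complex.star_def]
    ring
  simp only [this]
  rw [integral_finsetSum _ fun n _ => integrable_finsetSum _ fun k _ =>
    (integrable_pow_mul_star_pow hα hα1 _ _).const_mul _]
  push_cast
  refine Finset.sum_congr rfl fun n hn => ?_
  rw [integral_finsetSum _ fun k _ => (integrable_pow_mul_star_pow hα hα1 _ _).const_mul _,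
    Finset.sum_eq_single_of_mem n hn]
  · rw [integral_const_mul, Complex.star_def, Complex.mul_conj', ← integral_complex_ofReal]
    congr 1
    refine integral_congr_ae (ae_of_all _ fun ω => ?_)
    simp only [Complex.ofReal_pow, ← mul_pow, Complex.mul_conj', pow_mul]
  · intro k _ hk
    rw [integral_const_mul, hmom n k hk.symm, mul_zero]

lemma norm_charFun_logPoly_sub_le {α : Ω → ℂ} (hα : Measurable α) (hα1 : ∀ ω, ‖α ω‖ ≤ 1)
    (hmom : ∀ p q : ℕ, p ≠ q → ∫ ω, α ω ^ p * star (α ω) ^ q ∂P = 0)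
    (η : ℂ) {r : ℝ} (hr0 : 0 ≤ r) (hr1 : r ≤ 1) {M : ℕ}
    (hM : 2 ≤ M) :
    ‖(∫ ω, Complex.exp ((inner ℝ (-(logPoly r M).eval (α ω)) η : ℝ) * Complex.I) ∂P)
        - (1 - ((‖η‖ ^ 2 * (r ^ 2 * ∫ ω, ‖α ω‖ ^ 2 ∂P) / 4 : ℝ) : ℂ))‖
      ≤ 32 * ‖η‖ ^ 3 * (∫ ω, ‖α ω‖ ^ 2 ∂P) + 33 * ‖η‖ ^ 2 * ∫ ω, ‖α ω‖ ^ 4 ∂P := by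
  set c : ℕ → ℂ := fun n => -((r : ℂ) ^ n / n) with hc
  have hcn : ∀ n, ‖c n‖ = r ^ n / n := fun n => by
    simp [hc, abs_of_nonneg hr0]
  set X : Ω → ℂ := fun ω => -(logPoly r M).eval (α ω) with hX
  set Y : Ω → ℂ := fun ω => ∑ n ∈ Finset.Ioo 1 M, c n * α ω ^ n with hY
  set Z : Ω → ℂ := fun ω => -(r * α ω) with hZ
  have hXs : ∀ ω, X ω = ∑ n ∈ Finset.Ioo 0 M, c n * α ω ^ n := fun ω => by
    simp only [hX, eval_logPoly, hc]
    rw [← Finset.sum_neg_distrib]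
    symm
    refine Finset.sum_subset_zero_on_sdiff (fun n hn => ?_) (fun n hn => ?_) fun n hn => ?_
    · simp only [Finset.mem_Ioo] at hn; simpa using hn.2
    · have : n = 0 := by
        simp only [Finset.mem_sdiff, Finset.mem_range, Finset.mem_Ioo] at hn; omega
      simp [this]
    · rw [mul_pow]; ring
  have hXYZ : ∀ ω, X ω = Z ω + Y ω := fun ω => by
    have : Finset.Ioo 0 M = insert 1 (Finset.Ioo 1 M) := by ext n; simp; omega
    rw [hXs, this, Finset.sum_insert (by simp)]
    simp [hZ, hY, hc]
  have hnC : ∀ ω, ‖Y ω‖ ≤ 1 + ∑ n ∈ Finset.Ioo 1 M, ‖c n‖ := fun ω => by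
    refine ((norm_sum_le _ _).trans (Finset.sum_le_sum fun n _ => ?_)).trans
      (le_add_of_nonneg_left zero_le_one)
    rw [norm_mul, norm_pow]
    exact mul_le_of_le_one_right (norm_nonneg _) (pow_le_one₀ (norm_nonneg _) (hα1 ω))
  have hZα : ∀ ω, ‖Z ω‖ ≤ ‖α ω‖ := fun ω => by
    simp only [hZ, norm_neg, norm_mul, Complex.norm_real, Real.norm_of_nonneg hr0]
    exact mul_le_of_le_one_left (norm_nonneg _) hr1
  have hZC : ∀ ω, ‖Z ω‖ ≤ 1 + ∑ n ∈ Finset.Ioo 1 M, ‖c n‖ := fun ω =>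
    ((hZα ω).trans (hα1 ω)).trans (le_add_of_nonneg_right (Finset.sum_nonneg fun _ _ =>
      norm_nonneg _))
  have hYm : Measurable Y := Finset.measurable_sum _ fun n _ => (hα.pow_const n).const_mul _
  have hZm : Measurable Z := (hα.const_mul _).neg
  have h1 : ∫ ω, X ω ∂P = 0 := by
    simp only [hXs]; exact integral_sum_mul_pow hα hα1 hmom _ (by simp) c
  have h2 : ∫ ω, X ω ^ 2 ∂P = 0 := by
    simp only [hXs]; exact integral_sum_mul_pow_sq hα hα1 hmom _ (by simp) c
  have hY2 := integral_norm_sq_sum_mul_pow hα hα1 hmom (Finset.Ioo 1 M) c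
  have hX2 : ∫ ω, ‖X ω‖ ^ 2 ∂P = r ^ 2 * ∫ ω, ‖α ω‖ ^ 2 ∂P + ∫ ω, ‖Y ω‖ ^ 2 ∂P := by
    have : Finset.Ioo 0 M = insert 1 (Finset.Ioo 1 M) := by ext n; simp; omega
    simp only [hXs, hY2, hY, integral_norm_sq_sum_mul_pow hα hα1 hmom, this]
    rw [Finset.sum_insert (by simp)]
    simp [hcn]
  have hYle : ∫ ω, ‖Y ω‖ ^ 2 ∂P ≤ ∫ ω, ‖α ω‖ ^ 4 ∂P := by
    have ha : 0 ≤ ∫ ω, ‖α ω‖ ^ 4 ∂P := integral_nonneg fun _ => by positivity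
    have hs := sum_Ioo_inv_sq_le (α := ℝ) 1 M
    norm_num at hs
    calc ∫ ω, ‖Y ω‖ ^ 2 ∂P
        ≤ ∑ n ∈ Finset.Ioo 1 M, ((n : ℝ) ^ 2)⁻¹ * ∫ ω, ‖α ω‖ ^ 4 ∂P := by
          rw [hY2]
          refine Finset.sum_le_sum fun n hn => ?_
          rw [Finset.mem_Ioo] at hn
          refine mul_le_mul ?_ (integral_mono (integrable_norm_pow' hα hα1 _)
            (integrable_norm_pow' hα hα1 _) fun ω =>
            pow_le_pow_of_le_one (norm_nonneg _) (hα1 ω) (by omega))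
            (integral_nonneg fun _ => by positivity) (by positivity)
          rw [hcn, div_pow, div_eq_mul_inv]
          exact mul_le_of_le_one_left (by positivity) (pow_le_one₀ (by positivity)
            (pow_le_one₀ hr0 hr1))
      _ = (∑ n ∈ Finset.Ioo 1 M, ((n : ℝ) ^ 2)⁻¹) * ∫ ω, ‖α ω‖ ^ 4 ∂P := by
          rw [Finset.sum_mul]
      _ ≤ ∫ ω, ‖α ω‖ ^ 4 ∂P := mul_le_of_le_one_left ha hs
  have hZle : ∫ ω, ‖Z ω‖ ^ 3 ∂P ≤ ∫ ω, ‖α ω‖ ^ 2 ∂P := by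
    refine integral_mono_of_nonneg (ae_of_all _ fun ω => by positivity)
      (integrable_norm_pow' hα hα1 2) (ae_of_all _ fun ω => ?_)
    exact (pow_le_pow_left₀ (norm_nonneg _) (hZα ω) 3).trans
      (pow_le_pow_of_le_one (norm_nonneg _) (hα1 ω) (by norm_num))
  have hmain := norm_charFun_sub_le (P := P) hYm hZm hnC hZC hXYZ h1 h2 η
  have hY0 : 0 ≤ ∫ ω, ‖Y ω‖ ^ 2 ∂P := integral_nonneg fun _ => by positivity
  have hdiff : (∫ ω, Complex.exp ((inner ℝ (X ω) η : ℝ) * Complex.I) ∂P)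
        - (1 - ((‖η‖ ^ 2 * (r ^ 2 * ∫ ω, ‖α ω‖ ^ 2 ∂P) / 4 : ℝ) : ℂ))
      = ((∫ ω, Complex.exp ((inner ℝ (X ω) η : ℝ) * Complex.I) ∂P)
        - (1 - ((‖η‖ ^ 2 * (∫ ω, ‖X ω‖ ^ 2 ∂P) / 4 : ℝ) : ℂ)))
        - ((‖η‖ ^ 2 * (∫ ω, ‖Y ω‖ ^ 2 ∂P) / 4 : ℝ) : ℂ) := by
    rw [hX2]; push_cast; ring
  rw [hdiff]
  refine (norm_sub_le _ _).trans ?_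
  rw [Complex.norm_real, Real.norm_of_nonneg (by positivity)]
  have hη3 : 0 ≤ ‖η‖ ^ 3 := by positivity
  have hη2 : 0 ≤ ‖η‖ ^ 2 := by positivity
  have m1 := mul_le_mul_of_nonneg_left hZle hη3
  have m2 := mul_le_mul_of_nonneg_left hYle hη2
  have m3 : 0 ≤ ‖η‖ ^ 2 * ∫ ω, ‖Y ω‖ ^ 2 ∂P := by positivity
  linarith

lemma norm_charFun_log_sub_le {α : Ω → ℂ} (hα : Measurable α) (hα1 : ∀ ω, ‖α ω‖ ≤ 1)
    (hmom : ∀ p q : ℕ, p ≠ q → ∫ ω, α ω ^ p * star (α ω) ^ q ∂P = 0)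
    (hne : ∀ᵐ ω ∂P, α ω ≠ 1) (η : ℂ) :
    ‖(∫ ω, Complex.exp ((inner ℝ (Complex.log (1 - α ω)) η : ℝ) * Complex.I) ∂P)
        - (1 - ((‖η‖ ^ 2 * (∫ ω, ‖α ω‖ ^ 2 ∂P) / 4 : ℝ) : ℂ))‖
      ≤ 32 * ‖η‖ ^ 3 * (∫ ω, ‖α ω‖ ^ 2 ∂P) + 33 * ‖η‖ ^ 2 * ∫ ω, ‖α ω‖ ^ 4 ∂P := by
  have hcont : Continuous fun z : ℂ => Complex.exp ((inner ℝ z η : ℝ) * Complex.I) := by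
    fun_prop
  have hlim : ∀ {F : ℕ → Ω → ℂ} {f : Ω → ℂ}, (∀ k, Measurable (F k)) →
      (∀ᵐ ω ∂P, Tendsto (fun k => F k ω) atTop (nhds (f ω))) →
      Tendsto (fun k => ∫ ω, Complex.exp ((inner ℝ (F k ω) η : ℝ) * Complex.I) ∂P) atTop
        (nhds (∫ ω, Complex.exp ((inner ℝ (f ω) η : ℝ) * Complex.I) ∂P)) := fun hF h => by
    refine tendsto_integral_of_dominated_convergence (fun _ => 1)
      (fun k => (hcont.measurable.comp (hF k)).aestronglyMeasurable) (integrable_const _)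
      (fun k => ae_of_all _ fun ω => (Complex.norm_exp_ofReal_mul_I _).le) ?_
    filter_upwards [h] with ω hω
    exact (hcont.tendsto _).comp hω
  have h1 : ∀ l, ‖(∫ ω, Complex.exp
      ((inner ℝ (Complex.log (1 - radius l * α ω)) η : ℝ) * Complex.I) ∂P)
        - (1 - ((‖η‖ ^ 2 * (radius l ^ 2 * ∫ ω, ‖α ω‖ ^ 2 ∂P) / 4 : ℝ) : ℂ))‖
      ≤ 32 * ‖η‖ ^ 3 * (∫ ω, ‖α ω‖ ^ 2 ∂P) + 33 * ‖η‖ ^ 2 * ∫ ω, ‖α ω‖ ^ 4 ∂P := fun l => by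
    refine le_of_tendsto ((hlim (F := fun M ω => -(logPoly (radius l) M).eval (α ω))
      (fun M => ?_) (ae_of_all _ fun ω => ?_)).sub_const _).norm
      (eventually_atTop.2 ⟨2, fun M hM => norm_charFun_logPoly_sub_le hα hα1 hmom η
        (radius_nonneg l) (radius_lt_one l).le hM⟩)
    · exact ((logPoly (radius l) M).continuous.measurable.comp hα).neg
    · simpa using (tendsto_eval_logPoly (hα1 ω) l).neg
  refine le_of_tendsto (Tendsto.norm (Tendsto.sub
    (hlim (F := fun l ω => Complex.log (1 - radius l * α ω)) (fun l => ?_) ?_) ?_))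
    (Eventually.of_forall h1)
  · exact Complex.measurable_log.comp (measurable_const.sub (hα.const_mul _))
  · filter_upwards [hne] with ω hω
    exact tendsto_log_one_sub_radius_mul (hα1 ω) hω
  · have : Tendsto (fun l => ((‖η‖ ^ 2 * (radius l ^ 2 * ∫ ω, ‖α ω‖ ^ 2 ∂P) / 4 : ℝ) : ℂ)) atTop
        (nhds ((‖η‖ ^ 2 * (1 ^ 2 * ∫ ω, ‖α ω‖ ^ 2 ∂P) / 4 : ℝ) : ℂ)) :=
      (Complex.continuous_ofReal.tendsto _).comp
        ((((tendsto_radius.pow 2).mul_const _).const_mul _).div_const _)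
    rw [one_pow, one_mul] at this
    exact tendsto_const_nhds.sub this

end CharFunExpansion

section Reindex

variable {m n : Type*} [Fintype m] [DecidableEq m] [Fintype n] [DecidableEq n]

/-- Relabelling the rows and columns of a unitary matrix along an equivalence of index types. -/
def reindexUnitary (e : m ≃ n) (A : unitaryGroup m ℂ) : unitaryGroup n ℂ :=
  ⟨(A : Matrix m m ℂ).submatrix e.symm e.symm, by
    rw [mem_unitaryGroup_iff, star_eq_conjTranspose, conjTranspose_submatrix,
      submatrix_mul_equiv, ← star_eq_conjTranspose, mem_unitaryGroup_iff.1 A.2,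
      submatrix_one_equiv]⟩

lemma reindexUnitary_mul (e : m ≃ n) (A B : unitaryGroup m ℂ) :
    reindexUnitary e (A * B) = reindexUnitary e A * reindexUnitary e B := by
  ext1
  simp [reindexUnitary, submatrix_mul_equiv]

lemma reindexUnitary_symm_apply (e : m ≃ n) (A : unitaryGroup n ℂ) :
    reindexUnitary e (reindexUnitary e.symm A) = A := by
  ext1
  simp [reindexUnitary]

lemma measurable_reindexUnitary (e : m ≃ n) :
    Measurable (reindexUnitary e : unitaryGroup m ℂ → unitaryGroup n ℂ) :=
  Measurable.subtype_mk <| measurable_of_entries fun i j =>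
    measurable_unitary_entry (e.symm i) (e.symm j)

lemma regLogDet_reindexUnitary (e : m ≃ n) (A : unitaryGroup m ℂ) :
    regLogDet (reindexUnitary e A : Matrix n n ℂ) = regLogDet (A : Matrix m m ℂ) :=
  regLogDet_congr (charpoly_reindex e (A : Matrix m m ℂ))

instance isProbabilityMeasure_map_reindexUnitary (e : m ≃ n) (μ : Measure (unitaryGroup m ℂ))
    [IsProbabilityMeasure μ] : IsProbabilityMeasure (μ.map (reindexUnitary e)) :=
  Measure.isProbabilityMeasure_map (measurable_reindexUnitary e).aemeasurable

instance isMulLeftInvariant_map_reindexUnitary (e : m ≃ n) (μ : Measure (unitaryGroup m ℂ))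
    [μ.IsMulLeftInvariant] : (μ.map (reindexUnitary e)).IsMulLeftInvariant := by
  refine ⟨fun B => ?_⟩
  have hB : Measurable fun A : unitaryGroup m ℂ => reindexUnitary e.symm B * A :=
    measurable_const_mul _
  rw [Measure.map_map (measurable_const_mul B) (measurable_reindexUnitary e)]
  conv_rhs => rw [← map_mul_left_eq_self μ (reindexUnitary e.symm B)]
  rw [Measure.map_map (measurable_reindexUnitary e) hB]
  congr 1
  ext1 A
  simp [reindexUnitary_mul, reindexUnitary_symm_apply]

end Reindex

section Product

/-- The character `z ↦ exp(i ⟨z, η⟩)` of the real plane `ℂ`. -/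
def planeChar (η z : ℂ) : ℂ := Complex.exp ((inner ℝ z η : ℝ) * Complex.I)

lemma norm_planeChar (η z : ℂ) : ‖planeChar η z‖ = 1 := Complex.norm_exp_ofReal_mul_I _

lemma measurable_planeChar (η : ℂ) : Measurable (planeChar η) := by
  unfold planeChar
  fun_prop

lemma planeChar_add (η x y : ℂ) : planeChar η (x + y) = planeChar η x * planeChar η y := by
  simp only [planeChar, inner_add_left, Complex.ofReal_add, add_mul, Complex.exp_add]

lemma norm_integral_planeChar_le {Ω : Type*} [MeasurableSpace Ω] (P : Measure Ω)
    [IsProbabilityMeasure P] (η : ℂ) (f : Ω → ℂ) : ‖∫ ω, planeChar η (f ω) ∂P‖ ≤ 1 := by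
  simpa using norm_integral_le_of_norm_le_const (μ := P)
    (ae_of_all _ fun ω => (norm_planeChar η (f ω)).le)

lemma exists_planeChar_factor {n : ℕ} (μ : Measure (unitaryGroup (Fin (n + 1)) ℂ))
    [IsProbabilityMeasure μ] [μ.IsMulLeftInvariant] (ν : Measure (unitaryGroup (Fin n) ℂ))
    [IsProbabilityMeasure ν] [ν.IsMulLeftInvariant] (η : ℂ) :
    ∃ ψ : ℂ, ‖ψ‖ ≤ 1 ∧
      ‖ψ - (1 - (‖η‖ ^ 2 / 4 * ((n : ℝ) + 1)⁻¹ : ℝ))‖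
        ≤ 32 * ‖η‖ ^ 3 * ((n : ℝ) + 1)⁻¹ + 66 * ‖η‖ ^ 2 * (((n : ℝ) + 1) ^ 2)⁻¹ ∧
      ∫ A : unitaryGroup (Fin (n + 1)) ℂ,
          planeChar η (regLogDet (A : Matrix (Fin (n + 1)) (Fin (n + 1)) ℂ)) ∂μ
        = ψ * ∫ V : unitaryGroup (Fin n) ℂ,
            planeChar η (regLogDet (V : Matrix (Fin n) (Fin n) ℂ)) ∂ν := by
  have e : Fin (n + 1) ≃ Unit ⊕ Fin n := Fintype.equivOfCardEq (by simp [add_comm])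
  set P := μ.map (reindexUnitary e)
  have hcard : (Fintype.card (Unit ⊕ Fin n) : ℝ) = n + 1 := by simp [add_comm]
  have h2 : ∫ A : unitaryGroup (Unit ⊕ Fin n) ℂ,
      ‖(A : Matrix (Unit ⊕ Fin n) (Unit ⊕ Fin n) ℂ) (.inl ()) (.inl ())‖ ^ 2 ∂P
      = ((n : ℝ) + 1)⁻¹ := by
    have := integral_norm_sq (μ := P) (.inl ()) (.inl ())
    rw [hcard] at this
    exact eq_inv_of_mul_eq_one_right this
  have h4 : ∫ A : unitaryGroup (Unit ⊕ Fin n) ℂ,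
      ‖(A : Matrix (Unit ⊕ Fin n) (Unit ⊕ Fin n) ℂ) (.inl ()) (.inl ())‖ ^ 4 ∂P
      ≤ 2 * (((n : ℝ) + 1) ^ 2)⁻¹ := by
    have := integral_norm_pow_four (μ := P) (.inl ()) (.inl ())
    rw [hcard] at this
    rw [← div_eq_mul_inv, le_div_iff₀ (by positivity), ← this, mul_comm]
    gcongr
    nlinarith [(n.cast_nonneg : (0 : ℝ) ≤ n)]
  refine ⟨∫ A : unitaryGroup (Unit ⊕ Fin n) ℂ, planeChar η
    (Complex.log (1 - (A : Matrix (Unit ⊕ Fin n) (Unit ⊕ Fin n) ℂ) (.inl ()) (.inl ()))) ∂P,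
    norm_integral_planeChar_le P η _, ?_, ?_⟩
  · have h := norm_charFun_log_sub_le (P := P) (measurable_unitary_entry (Sum.inl ()) (Sum.inl ()))
      (fun A => norm_entry_le_one A (Sum.inl ()) (Sum.inl ()))
      (fun p q hpq => integral_pow_mul_conj_pow (Sum.inl ()) (Sum.inl ()) hpq)
      (ae_diag_ne_one (Sum.inl ())) η
    rw [h2] at h
    have h5 : ‖η‖ ^ 2 / 4 * ((n : ℝ) + 1)⁻¹ = ‖η‖ ^ 2 * ((n : ℝ) + 1)⁻¹ / 4 := by ring
    rw [h5]
    refine h.trans ?_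
    nlinarith [mul_le_mul_of_nonneg_left h4 (sq_nonneg ‖η‖)]
  · have h := integral_map (μ := μ) (measurable_reindexUnitary e).aemeasurable
      ((measurable_planeChar η).comp measurable_regLogDet).aestronglyMeasurable
    rw [← integral_regLogDet_eq_mul P ν (measurable_planeChar η)
      (fun z => (norm_planeChar η z).le) (planeChar_add η)]
    simpa only [Function.comp_def, regLogDet_reindexUnitary] using h.symm

lemma abs_one_sub_sub_exp_neg_le {t : ℝ} (ht : 0 ≤ t) : |1 - t - Real.exp (-t)| ≤ t ^ 2 := by
  rcases le_or_gt t 1 with h | h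
  · have := Real.abs_exp_sub_one_sub_id_le (x := -t) (by rwa [abs_neg, abs_of_nonneg ht])
    rw [abs_sub_comm]
    convert this using 1 <;> ring_nf
  · rw [abs_le]
    have h1 := Real.exp_pos (-t)
    have h2 : Real.exp (-t) ≤ 1 := Real.exp_le_one_iff.2 (by linarith)
    constructor <;> nlinarith

lemma norm_integral_planeChar_regLogDet_sub_le (μ : (N : ℕ) → Measure (unitaryGroup (Fin N) ℂ))
    [∀ N, IsProbabilityMeasure (μ N)] [∀ N, (μ N).IsMulLeftInvariant] (η : ℂ) (N : ℕ) :
    ‖(∫ A : unitaryGroup (Fin N) ℂ, planeChar η (regLogDet (A : Matrix (Fin N) (Fin N) ℂ)) ∂μ N)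
        - (Real.exp (-(‖η‖ ^ 2 / 4 * ∑ k ∈ Finset.range N, ((k : ℝ) + 1)⁻¹)) : ℂ)‖
      ≤ 32 * ‖η‖ ^ 3 * ∑ k ∈ Finset.range N, ((k : ℝ) + 1)⁻¹
        + (66 * ‖η‖ ^ 2 + ‖η‖ ^ 4 / 16) * ∑ k ∈ Finset.range N, (((k : ℝ) + 1) ^ 2)⁻¹ := by
  induction N with
  | zero =>
    have h0 (A : unitaryGroup (Fin 0) ℂ) : regLogDet (A : Matrix (Fin 0) (Fin 0) ℂ) = 0 := by
      simp [regLogDet, logDet]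
    simp [h0, planeChar]
  | succ n ih =>
    obtain ⟨ψ, hψ1, hψ, hmul⟩ := exists_planeChar_factor (μ (n + 1)) (μ n) η
    rw [hmul]
    simp only [Finset.sum_range_succ, mul_add, neg_add, Real.exp_add, Complex.ofReal_mul]
    set Φ := ∫ V : unitaryGroup (Fin n) ℂ,
      planeChar η (regLogDet (V : Matrix (Fin n) (Fin n) ℂ)) ∂μ n
    set S := ∑ k ∈ Finset.range n, ((k : ℝ) + 1)⁻¹
    set t := ‖η‖ ^ 2 / 4 * ((n : ℝ) + 1)⁻¹ with ht
    have hE : ‖(Real.exp (-(‖η‖ ^ 2 / 4 * S)) : ℂ)‖ ≤ 1 := by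
      rw [Complex.norm_real, Real.norm_of_nonneg (Real.exp_pos _).le, Real.exp_le_one_iff]
      have : 0 ≤ S := Finset.sum_nonneg fun k _ => by positivity
      have : 0 ≤ ‖η‖ ^ 2 / 4 * S := by positivity
      linarith
    have ht2 : ‖(1 - (t : ℂ)) - (Real.exp (-t) : ℂ)‖ ≤ ‖η‖ ^ 4 / 16 * (((n : ℝ) + 1) ^ 2)⁻¹ := by
      have := abs_one_sub_sub_exp_neg_le (t := t) (by positivity)
      rw [← Real.norm_eq_abs, ← Complex.norm_real] at this
      push_cast at this ⊢
      refine this.trans (le_of_eq ?_)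
      rw [ht, mul_pow, inv_pow]
      ring
    calc ‖ψ * Φ - (Real.exp (-(‖η‖ ^ 2 / 4 * S)) : ℂ) * (Real.exp (-t) : ℂ)‖
        = ‖ψ * (Φ - (Real.exp (-(‖η‖ ^ 2 / 4 * S)) : ℂ))
          + (ψ - (1 - (t : ℂ)) + ((1 - (t : ℂ)) - (Real.exp (-t) : ℂ)))
            * (Real.exp (-(‖η‖ ^ 2 / 4 * S)) : ℂ)‖ := by ring_nf
      _ ≤ 1 * ‖Φ - (Real.exp (-(‖η‖ ^ 2 / 4 * S)) : ℂ)‖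
          + (‖ψ - (1 - (t : ℂ))‖ + ‖(1 - (t : ℂ)) - (Real.exp (-t) : ℂ)‖) * 1 := by
        refine (norm_add_le _ _).trans ?_
        rw [norm_mul, norm_mul]
        gcongr
        exact norm_add_le _ _
      _ ≤ _ := by
        rw [one_mul, mul_one]
        linarith

end Product

section Asymptotics

/-- The normalization `√((1/2) log N)`. -/
def scale (N : ℕ) : ℝ := Real.sqrt ((1 / 2) * Real.log N)

lemma tendsto_log_natCast : Tendsto (fun N : ℕ => Real.log N) atTop atTop :=
  Real.tendsto_log_atTop.comp tendsto_natCast_atTop_atTop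

lemma tendsto_inv_scale : Tendsto (fun N => (scale N)⁻¹) atTop (nhds 0) :=
  (Real.tendsto_sqrt_atTop.comp
    (tendsto_log_natCast.const_mul_atTop (by norm_num : (0 : ℝ) < 1 / 2))).inv_tendsto_atTop

lemma scale_sq {N : ℕ} : scale N ^ 2 = 1 / 2 * Real.log N :=
  Real.sq_sqrt (mul_nonneg (by norm_num) (Real.log_natCast_nonneg N))

lemma sum_range_inv_eq_harmonic (N : ℕ) :
    ∑ k ∈ Finset.range N, ((k : ℝ) + 1)⁻¹ = harmonic N := by
  simp [harmonic]

lemma tendsto_harmonic_div_log :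
    Tendsto (fun N : ℕ => (harmonic N : ℝ) / Real.log N) atTop (nhds 1) := by
  have h1 : Tendsto (fun N : ℕ => 1 + (Real.log N)⁻¹) atTop (nhds 1) := by
    simpa using tendsto_log_natCast.inv_tendsto_atTop.const_add 1
  refine tendsto_of_tendsto_of_tendsto_of_le_of_le' tendsto_const_nhds h1 ?_ ?_
  · filter_upwards [tendsto_log_natCast.eventually_gt_atTop 0, eventually_gt_atTop 0] with N hN hN0
    rw [le_div_iff₀ hN, one_mul]
    refine le_trans (Real.log_le_log (by exact_mod_cast hN0) ?_) (log_add_one_le_harmonic N)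
    simp
  · filter_upwards [tendsto_log_natCast.eventually_gt_atTop 0] with N hN
    rw [div_le_iff₀ hN, add_mul, inv_mul_cancel₀ hN.ne', one_mul, add_comm]
    exact harmonic_le_one_add_log N

lemma tendsto_inv_scale_sq_mul_sum :
    Tendsto (fun N : ℕ => (scale N)⁻¹ ^ 2 * ∑ k ∈ Finset.range N, ((k : ℝ) + 1)⁻¹)
      atTop (nhds 2) := by
  have h := tendsto_harmonic_div_log.const_mul 2
  rw [mul_one] at h
  refine h.congr fun N => ?_
  rw [sum_range_inv_eq_harmonic, inv_pow, scale_sq, mul_inv]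
  ring

lemma sum_inv_sq_le_tsum (N : ℕ) :
    ∑ k ∈ Finset.range N, (((k : ℝ) + 1) ^ 2)⁻¹ ≤ ∑' k : ℕ, (((k : ℝ) + 1) ^ 2)⁻¹ := by
  refine Summable.sum_le_tsum _ (fun k _ => by positivity) ?_
  have h := (summable_nat_add_iff 1).2 (Real.summable_nat_pow_inv.2 one_lt_two)
  simpa using h

end Asymptotics

section Limit

variable (μ : (N : ℕ) → Measure (unitaryGroup (Fin N) ℂ))

/-- The law of the regularized `log det (1 - A)`, divided by `scale N`, as a measure on `ℂ`. -/
def scaledLaw (N : ℕ) : Measure ℂ :=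
  (μ N).map fun A : unitaryGroup (Fin N) ℂ =>
    regLogDet (A : Matrix (Fin N) (Fin N) ℂ) / (scale N : ℂ)

lemma measurable_regLogDet_div (N : ℕ) : Measurable fun A : unitaryGroup (Fin N) ℂ =>
    regLogDet (A : Matrix (Fin N) (Fin N) ℂ) / (scale N : ℂ) :=
  measurable_regLogDet.div_const _

instance isProbabilityMeasure_scaledLaw (N : ℕ) [IsProbabilityMeasure (μ N)] :
    IsProbabilityMeasure (scaledLaw μ N) :=
  Measure.isProbabilityMeasure_map (measurable_regLogDet_div N).aemeasurable

lemma planeChar_div_ofReal (ξ z : ℂ) (s : ℝ) :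
    planeChar ξ (z / s) = planeChar ((s⁻¹ : ℝ) • ξ) z := by
  have : z / s = (s⁻¹ : ℝ) • z := by
    rw [Complex.real_smul, Complex.ofReal_inv, div_eq_inv_mul]
  rw [planeChar, planeChar, this, real_inner_smul_left, real_inner_smul_right]

lemma charFun_scaledLaw (N : ℕ) (ξ : ℂ) : charFun (scaledLaw μ N) ξ
    = ∫ A : unitaryGroup (Fin N) ℂ,
        planeChar (((scale N)⁻¹ : ℝ) • ξ) (regLogDet (A : Matrix (Fin N) (Fin N) ℂ)) ∂μ N := by
  rw [charFun_apply, scaledLaw]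
  change ∫ z, planeChar ξ z ∂_ = _
  rw [integral_map (measurable_regLogDet_div N).aemeasurable
    (measurable_planeChar ξ).aestronglyMeasurable]
  simp only [planeChar_div_ofReal]

lemma tendsto_charFun_scaledLaw [∀ N, IsProbabilityMeasure (μ N)]
    [∀ N, (μ N).IsMulLeftInvariant] (ξ : ℂ) :
    Tendsto (fun N => charFun (scaledLaw μ N) ξ) atTop
      (nhds (Real.exp (-(‖ξ‖ ^ 2 / 2)) : ℂ)) := by
  set H : ℕ → ℝ := fun N => ∑ k ∈ Finset.range N, ((k : ℝ) + 1)⁻¹ with hH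
  set C : ℝ := ∑' k : ℕ, (((k : ℝ) + 1) ^ 2)⁻¹ with hC
  have hmain : Tendsto (fun N => (Real.exp (-(‖((scale N)⁻¹ : ℝ) • ξ‖ ^ 2 / 4 * H N)) : ℂ)) atTop
      (nhds (Real.exp (-(‖ξ‖ ^ 2 / 2)) : ℂ)) := by
    refine (Complex.continuous_ofReal.tendsto _).comp ((Real.continuous_exp.tendsto _).comp ?_)
    have h := (tendsto_inv_scale_sq_mul_sum.const_mul (‖ξ‖ ^ 2 / 4)).neg
    convert h using 2 with N
    · rw [norm_smul, mul_pow, Real.norm_eq_abs, sq_abs]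
      ring
    · ring
  have herr : Tendsto (fun N => 32 * ‖((scale N)⁻¹ : ℝ) • ξ‖ ^ 3 * H N
      + (66 * ‖((scale N)⁻¹ : ℝ) • ξ‖ ^ 2 + ‖((scale N)⁻¹ : ℝ) • ξ‖ ^ 4 / 16) * C) atTop
      (nhds 0) := by
    have hη : Tendsto (fun N => ‖((scale N)⁻¹ : ℝ) • ξ‖) atTop (nhds 0) := by
      simpa using (tendsto_inv_scale.smul_const ξ).norm
    have h1 := ((hη.mul tendsto_inv_scale_sq_mul_sum).const_mul (32 * ‖ξ‖ ^ 2)).add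
      ((((hη.pow 2).const_mul 66).add ((hη.pow 4).div_const 16)).mul_const C)
    convert h1 using 2 with N
    · simp only [norm_smul, Real.norm_eq_abs]
      have := sq_abs (scale N)⁻¹
      rw [← this]
      ring
    · norm_num
  have hdiff : Tendsto (fun N => charFun (scaledLaw μ N) ξ
      - (Real.exp (-(‖((scale N)⁻¹ : ℝ) • ξ‖ ^ 2 / 4 * H N)) : ℂ)) atTop (nhds 0) := by
    refine squeeze_zero_norm (fun N => ?_) herr
    rw [charFun_scaledLaw]
    refine (norm_integral_planeChar_regLogDet_sub_le μ _ N).trans ?_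
    gcongr
    exact sum_inv_sq_le_tsum N
  simpa using hdiff.add hmain

/-- The standard Gaussian measure on `ℂ`: independent standard normal real and imaginary parts. -/
def stdGaussianComplex : Measure ℂ :=
  ((ProbabilityTheory.gaussianReal 0 1).prod (ProbabilityTheory.gaussianReal 0 1)).map
    Complex.measurableEquivRealProd.symm

instance isProbabilityMeasure_stdGaussianComplex : IsProbabilityMeasure stdGaussianComplex :=
  Measure.isProbabilityMeasure_map Complex.measurableEquivRealProd.symm.measurable.aemeasurable

lemma charFun_stdGaussianComplex (ξ : ℂ) :
    charFun stdGaussianComplex ξ = (Real.exp (-(‖ξ‖ ^ 2 / 2)) : ℂ) := by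
  rw [charFun_apply, stdGaussianComplex, integral_map_equiv]
  have h (p : ℝ × ℝ) : Complex.exp ((inner ℝ (Complex.measurableEquivRealProd.symm p) ξ : ℝ)
      * Complex.I) = Complex.exp (ξ.re * p.1 * Complex.I) * Complex.exp (ξ.im * p.2 * Complex.I) := by
    rw [← Complex.exp_add, Complex.inner]
    congr 1
    simp [Complex.measurableEquivRealProd]
    ring
  simp only [h]
  rw [integral_prod_mul (fun x : ℝ => Complex.exp (ξ.re * x * Complex.I))
    (fun y : ℝ => Complex.exp (ξ.im * y * Complex.I)), ← charFun_apply_real, ← charFun_apply_real,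
    ProbabilityTheory.charFun_gaussianReal, ProbabilityTheory.charFun_gaussianReal,
    ← Complex.exp_add, Complex.sq_norm, Complex.normSq_apply]
  push_cast
  congr 1
  simp
  ring

lemma stdGaussianComplex_reProdIm (s t : Set ℝ) :
    stdGaussianComplex (s ×ℂ t)
      = ProbabilityTheory.gaussianReal 0 1 s * ProbabilityTheory.gaussianReal 0 1 t := by
  rw [stdGaussianComplex, MeasurableEquiv.map_apply, ← Measure.prod_prod]
  rfl

lemma stdGaussianComplex_frontier_rect {a b c d : ℝ} (hab : a < b) (hcd : c < d) :
    stdGaussianComplex (frontier (Set.Ioo a b ×ℂ Set.Ioo c d)) = 0 := by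
  have h {a b : ℝ} (hab : a < b) :
      ProbabilityTheory.gaussianReal 0 1 (frontier (Set.Ioo a b)) = 0 := by
    have := ProbabilityTheory.nullSingletonClass_gaussianReal (μ := 0) (v := 1) one_ne_zero
    rw [frontier_Ioo hab]
    exact (Set.toFinite {a, b}).measure_zero _
  rw [Complex.frontier_reProdIm]
  refine measure_union_null ?_ ?_ <;> rw [stdGaussianComplex_reProdIm]
  · rw [h hcd, mul_zero]
  · rw [h hab, zero_mul]

lemma gaussianReal_Ioo_toReal {a b : ℝ} (hab : a < b) :
    (ProbabilityTheory.gaussianReal 0 1 (Set.Ioo a b)).toReal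
      = (Real.sqrt (2 * Real.pi))⁻¹ * ∫ x in a..b, Real.exp (-x ^ 2 / 2) := by
  rw [ProbabilityTheory.gaussianReal_apply_eq_integral _ one_ne_zero, ENNReal.toReal_ofReal
    (integral_nonneg fun x => ProbabilityTheory.gaussianPDFReal_nonneg _ _ _),
    intervalIntegral.integral_of_le hab.le, ← integral_Ioc_eq_integral_Ioo, ← integral_const_mul]
  simp [ProbabilityTheory.gaussianPDFReal]

lemma stdGaussianComplex_rect_toReal {a b c d : ℝ} (hab : a < b) (hcd : c < d) :
    (stdGaussianComplex (Set.Ioo a b ×ℂ Set.Ioo c d)).toReal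
      = (1 / (2 * Real.pi)) * ∫ x in a..b, ∫ y in c..d, Real.exp (-(x ^ 2 + y ^ 2) / 2) := by
  have h (x y : ℝ) : Real.exp (-(x ^ 2 + y ^ 2) / 2)
      = Real.exp (-x ^ 2 / 2) * Real.exp (-y ^ 2 / 2) := by
    rw [← Real.exp_add]
    ring_nf
  have hpi : (Real.sqrt (2 * Real.pi))⁻¹ * (Real.sqrt (2 * Real.pi))⁻¹ = 1 / (2 * Real.pi) := by
    rw [← mul_inv, Real.mul_self_sqrt (by positivity), one_div]
  simp only [h, intervalIntegral.integral_const_mul, intervalIntegral.integral_mul_const]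
  rw [stdGaussianComplex_reProdIm, ENNReal.toReal_mul, gaussianReal_Ioo_toReal hab,
    gaussianReal_Ioo_toReal hcd, ← hpi]
  ring

lemma tendsto_scaledLaw_rect [∀ N, IsProbabilityMeasure (μ N)]
    [∀ N, (μ N).IsMulLeftInvariant] {a b c d : ℝ} (hab : a < b) (hcd : c < d) :
    Tendsto (fun N => scaledLaw μ N (Set.Ioo a b ×ℂ Set.Ioo c d)) atTop
      (nhds (stdGaussianComplex (Set.Ioo a b ×ℂ Set.Ioo c d))) := by
  let Q : ℕ → ProbabilityMeasure ℂ := fun N => ⟨scaledLaw μ N, inferInstance⟩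
  let G : ProbabilityMeasure ℂ := ⟨stdGaussianComplex, inferInstance⟩
  have h : Tendsto Q atTop (nhds G) := by
    refine ProbabilityMeasure.tendsto_of_tendsto_charFun fun ξ => ?_
    simpa only [Q, G, ProbabilityMeasure.coe_mk, charFun_stdGaussianComplex]
      using tendsto_charFun_scaledLaw μ ξ
  exact ProbabilityMeasure.tendsto_measure_of_null_frontier_of_tendsto' h
    (stdGaussianComplex_frontier_rect hab hcd)

lemma measure_logDet_phase_eq_scaledLaw (N : ℕ) [IsProbabilityMeasure (μ N)]
    [(μ N).IsMulLeftInvariant] (θ : ℝ) {E : Set ℂ} (hE : MeasurableSet E) :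
    μ N {A | logDet (Complex.exp (-(θ : ℂ) * Complex.I) • (A : Matrix (Fin N) (Fin N) ℂ))
      / (scale N : ℂ) ∈ E} = scaledLaw μ N E := by
  rw [scaledLaw, Measure.map_apply (measurable_regLogDet_div N) hE,
    ← measure_preimage_mul (μ N) (phase (-θ)) (_ ⁻¹' E)]
  refine measure_congr ?_
  have h : ∀ᵐ A : unitaryGroup (Fin N) ℂ ∂μ N,
      (1 - ((phase (-θ) * A : unitaryGroup (Fin N) ℂ) : Matrix (Fin N) (Fin N) ℂ)).det ≠ 0 :=
    (measurePreserving_mul_left (μ N) (phase (-θ))).quasiMeasurePreserving.ae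
      ae_det_one_sub_ne_zero
  filter_upwards [h] with A hA
  refine propext ?_
  change _ / _ ∈ E ↔ _ / _ ∈ E
  rw [regLogDet, if_neg hA, coe_phase_mul, Complex.ofReal_neg]

end Limit

end KeatingSnaith

/-- **Keating–Snaith central limit theorem.** Fix `θ ∈ ℝ`. For every rectangle
`B = {z : a < Re z < b, c < Im z < d}`, the Haar measure of the set of `A ∈ U(N)` with
`log P_N(A,θ)/√((1/2)·log N) ∈ B` converges, as `N → ∞`, to
`(1/2π)·∫_a^b ∫_c^d e^{−(x²+y²)/2} dy dx`. -/
theorem keating_snaith_clt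
    (μ : (N : ℕ) → Measure (Matrix.unitaryGroup (Fin N) ℂ))
    (hμ : ∀ N, IsHaarProb (μ N))
    (θ : ℝ) (a b c d : ℝ) (hab : a < b) (hcd : c < d) :
    Tendsto
      (fun N : ℕ =>
        (μ N {A | a < (logCharPoly N A θ / (Real.sqrt ((1/2) * Real.log N) : ℂ)).re ∧
                  (logCharPoly N A θ / (Real.sqrt ((1/2) * Real.log N) : ℂ)).re < b ∧
                  c < (logCharPoly N A θ / (Real.sqrt ((1/2) * Real.log N) : ℂ)).im ∧
                  (logCharPoly N A θ / (Real.sqrt ((1/2) * Real.log N) : ℂ)).im < d}).toReal)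
      atTop
      (nhds ((1 / (2 * Real.pi)) *
        ∫ x in a..b, ∫ y in c..d, Real.exp (-(x ^ 2 + y ^ 2) / 2))) := by
  have hprob (N : ℕ) : IsProbabilityMeasure (μ N) := (hμ N).1
  have hinv (N : ℕ) : (μ N).IsMulLeftInvariant := ⟨(hμ N).2⟩
  rw [← KeatingSnaith.stdGaussianComplex_rect_toReal hab hcd]
  refine ((ENNReal.tendsto_toReal (measure_ne_top _ _)).comp
    (KeatingSnaith.tendsto_scaledLaw_rect μ hab hcd)).congr fun N => ?_
  rw [Function.comp_apply, ← KeatingSnaith.measure_logDet_phase_eq_scaledLaw μ N θ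
    (isOpen_Ioo.reProdIm isOpen_Ioo).measurableSet]
  simp only [KeatingSnaith.logCharPoly_eq_logDet, Complex.mem_reProdIm, Set.mem_Ioo, and_assoc,
    KeatingSnaith.scale]
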